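/- Extraction of expansion coefficients from nonlinear feature inner products (Lemma A.2). Under the random features setup and the data, activation, and scaling assumptions: there exist constants c, C > 0 such that for all sufficiently large d, with probability at least 1 − 2 exp(−c log² d) over V and the data, the following holds simultaneously for every x̂ ∈ ℝ^d with ‖x̂‖_2 = √d and every a ∈ ℝⁿ with φ(x̂) = Σ_{i=1}^n a_i φ(x_i): for every i ∈ [n], |φ̃(x_i)ᵀφ̃(x̂) − μ̃² p a_i| ≤ C (‖a‖_2 + 1) ( √(p d) log d + √(p n) log d + p √n log³ d / d^{3/2} ). -/

import Mathlib

open MeasureTheory ProbabilityTheory Filter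

noncomputable section

/-- Euclidean (ℓ²) norm of a vector in `Fin m → ℝ`. -/
def eNorm {m : ℕ} (x : Fin m → ℝ) : ℝ := Real.sqrt (∑ j, (x j) ^ 2)

/-- Euclidean dot product. -/
def dotp {m : ℕ} (u v : Fin m → ℝ) : ℝ := ∑ j, u j * v j

/-- The random-features map `x ↦ (φ(vₖᵀx))ₖ`, where `vₖ` is the `k`-th row of `V`. -/
def featureMap {p d : ℕ} (φ : ℝ → ℝ) (V : Fin p → Fin d → ℝ) (x : Fin d → ℝ) :
    Fin p → ℝ := fun k => φ (dotp (V k) x)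

/-- The `l`-th normalized probabilists' Hermite polynomial (orthonormal in `L²(N(0,1))`). -/
def hermiteFn (l : ℕ) (x : ℝ) : ℝ :=
  (Polynomial.aeval x (Polynomial.hermite l)) / Real.sqrt (Nat.factorial l)

/-- The `l`-th Hermite coefficient `μ_l` of `φ`. -/
def hermiteCoeff (φ : ℝ → ℝ) (l : ℕ) : ℝ :=
  ∫ g, φ g * hermiteFn l g ∂(gaussianReal 0 1)

/-- The nonlinear part of the feature map: `φ̃(x) = (φ(vₖᵀx) − μ₁ vₖᵀx)ₖ`. -/
def tfeatureMap {p d : ℕ} (φ : ℝ → ℝ) (V : Fin p → Fin d → ℝ) (x : Fin d → ℝ) :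
    Fin p → ℝ := fun k => φ (dotp (V k) x) - hermiteCoeff φ 1 * dotp (V k) x

/-- `μ̃² := Σ_{l ≥ 3} μ_l²`. -/
def tmu2 (φ : ℝ → ℝ) : ℝ := ∑' l : ℕ, if 3 ≤ l then (hermiteCoeff φ l) ^ 2 else 0

/-- The law of the random features matrix: i.i.d. entries `N(0, 1/d)`. -/
def gaussianMatrix (p d : ℕ) : Measure (Fin p → Fin d → ℝ) :=
  Measure.pi fun _ => Measure.pi fun _ => gaussianReal 0 ((d : NNReal))⁻¹

/-- Sub-Gaussian norm of a distribution on `ℝ^d`: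
`sup_{‖u‖₂ = 1} inf { t > 0 : E exp((uᵀx)²/t²) ≤ 2 }`. -/
def vecSubGNorm {d : ℕ} (P : Measure (Fin d → ℝ)) : ℝ :=
  ⨆ u : {u : Fin d → ℝ // eNorm u = 1},
    sInf {t : ℝ | 0 < t ∧ ∫ x, Real.exp ((dotp u.1 x) ^ 2 / t ^ 2) ∂P ≤ 2}

/-- Data assumption: `P` is a probability distribution on `ℝ^d` with `‖x‖₂ = √d` a.s.
and sub-Gaussian norm at most `K`. -/
structure DataAssumption {d : ℕ} (P : Measure (Fin d → ℝ)) (K : ℝ) : Prop where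
  prob : IsProbabilityMeasure P
  norm_eq : ∀ᵐ x ∂P, eNorm x = Real.sqrt d
  subg : vecSubGNorm P ≤ K

/-- Core activation assumption: `φ` is non-linear, Lipschitz, with Lipschitz derivative,
`μ₀ = μ₂ = 0` and `μ₁ ≠ 0`. -/
structure ActivationAssumptionCore (φ : ℝ → ℝ) : Prop where
  nonlinear : ¬ ∃ a b : ℝ, ∀ z, φ z = a * z + b
  lipschitz : ∃ L : NNReal, LipschitzWith L φ
  differentiable : Differentiable ℝ φ
  deriv_lipschitz : ∃ L' : NNReal, LipschitzWith L' (deriv φ)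
  mu0 : hermiteCoeff φ 0 = 0
  mu2 : hermiteCoeff φ 2 = 0
  mu1 : hermiteCoeff φ 1 ≠ 0

/-- Full activation assumption: additionally, there are two non-zero Hermite coefficients
of order ≥ 3 with different parity. -/
structure ActivationAssumption (φ : ℝ → ℝ) extends ActivationAssumptionCore φ : Prop where
  parity : ∃ l l' : ℕ, 3 ≤ l ∧ 3 ≤ l' ∧ l % 2 ≠ l' % 2 ∧
    hermiteCoeff φ l ≠ 0 ∧ hermiteCoeff φ l' ≠ 0

abbrev stdG : Measure ℝ := gaussianReal 0 1

lemma integrable_pow_stdG (n : ℕ) : Integrable (fun x : ℝ => x ^ n) stdG := by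
  have h := integrable_pow_of_integrable_exp_mul (μ := stdG) (X := id) (t := 1) one_ne_zero
    (by simpa using integrable_exp_mul_gaussianReal (μ := 0) (v := 1) 1)
    (by simpa using integrable_exp_mul_gaussianReal (μ := 0) (v := 1) (-1)) n
  simpa using h

lemma integrable_poly_stdG (q : Polynomial ℝ) : Integrable (fun x : ℝ => q.eval x) stdG := by
  induction q using Polynomial.induction_on' with
  | add p q hp hq => exact (hp.add hq).congr (ae_of_all _ fun x => by simp)
  | monomial n a =>
    exact ((integrable_pow_stdG n).const_mul a).congr (ae_of_all _ fun x => by simp)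

lemma integrable_stdG_iff {f : ℝ → ℝ} :
    Integrable f stdG ↔ Integrable (fun x => gaussianPDFReal 0 1 x * f x) := by
  rw [stdG, gaussianReal_of_var_ne_zero 0 one_ne_zero,
    integrable_withDensity_iff_integrable_smul' (measurable_gaussianPDF _ _)
      (by simp [gaussianPDF])]
  simp [toReal_gaussianPDF]

lemma hasDerivAt_pdf (x : ℝ) :
    HasDerivAt (gaussianPDFReal 0 1) (-x * gaussianPDFReal 0 1 x) x := by
  unfold gaussianPDFReal
  have h : HasDerivAt (fun x : ℝ => -(x - 0) ^ 2 / (2 * ((1 : NNReal) : ℝ))) (-x) x := by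
    have := (((hasDerivAt_id x).sub_const 0).pow 2).neg.div_const (2 * ((1 : NNReal) : ℝ))
    exact this.congr_deriv (by simp; ring)
  exact (h.exp.const_mul (√(2 * Real.pi * ((1 : NNReal) : ℝ)))⁻¹).congr_deriv (by ring)

lemma stein_poly (q : Polynomial ℝ) :
    ∫ x, x * q.eval x ∂stdG = ∫ x, q.derivative.eval x ∂stdG := by
  have h1 : Integrable (fun x : ℝ => x * q.eval x) stdG := by
    exact (integrable_poly_stdG (Polynomial.X * q)).congr (ae_of_all _ fun x => by simp)
  have h2 := integrable_poly_stdG q.derivative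
  have h3 := integrable_poly_stdG q
  have key := integral_eq_zero_of_hasDerivAt_of_integrable
    (f := fun x => gaussianPDFReal 0 1 x * q.eval x)
    (f' := fun x => gaussianPDFReal 0 1 x * (q.derivative.eval x - x * q.eval x))
    (fun x => ((hasDerivAt_pdf x).mul (q.hasDerivAt x)).congr_deriv (by ring))
    (integrable_stdG_iff.1 (h2.sub h1)) (integrable_stdG_iff.1 h3)
  have := integral_gaussianReal_eq_integral_smul (μ := 0) (v := 1)
    (f := fun x => q.derivative.eval x - x * q.eval x) one_ne_zero
  simp only [smul_eq_mul] at this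
  rw [key, integral_sub h2 h1] at this
  linarith

/-- The real Hermite polynomial. -/
def heR (l : ℕ) : Polynomial ℝ := (Polynomial.hermite l).map (Int.castRingHom ℝ)

lemma heR_zero : heR 0 = 1 := by simp [heR]
lemma heR_one : heR 1 = Polynomial.X := by simp [heR]
lemma heR_succ (l : ℕ) : heR (l + 1) = Polynomial.X * heR l - (heR l).derivative := by
  simp [heR, Polynomial.hermite_succ, Polynomial.derivative_map]

lemma heR_deriv (l : ℕ) : (heR (l + 1)).derivative = ((l : ℝ) + 1) • heR l := by
  induction l with
  | zero => simp [heR_one, heR_zero]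
  | succ l ih =>
    rw [heR_succ (l + 1), Polynomial.derivative_sub, Polynomial.derivative_mul, ih,
      Polynomial.derivative_smul, heR_succ l]
    simp only [Polynomial.derivative_X, Polynomial.smul_eq_C_mul]
    push_cast
    simp only [map_add, map_one]
    ring

lemma heR_rec (l : ℕ) :
    heR (l + 2) = Polynomial.X * heR (l + 1) - ((l : ℝ) + 1) • heR l := by
  rw [heR_succ (l + 1), heR_deriv]

lemma hermiteFn_eq (l : ℕ) (x : ℝ) :
    hermiteFn l x = (heR l).eval x / Real.sqrt (Nat.factorial l) := by
  simp [hermiteFn, heR, Polynomial.aeval_def, Polynomial.eval₂_eq_eval_map]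

/-- integrating `He_{l+1}` against polynomials -/
lemma heR_ibp (l : ℕ) (q : Polynomial ℝ) :
    ∫ x, (heR (l + 1)).eval x * q.eval x ∂stdG
      = ∫ x, (heR l).eval x * q.derivative.eval x ∂stdG := by
  have h := stein_poly (heR l * q)
  have e1 : ∀ x, (heR (l + 1)).eval x * q.eval x
      = (Polynomial.X * (heR l * q)).eval x - ((heR l).derivative * q).eval x := by
    intro x; simp [heR_succ]; ring
  have e2 : ∀ x, (heR l * q).derivative.eval x
      = ((heR l).derivative * q).eval x + (heR l * q.derivative).eval x := by
    intro x; simp [Polynomial.derivative_mul]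
  simp_rw [e1]
  rw [integral_sub (integrable_poly_stdG _) (integrable_poly_stdG _)]
  simp_rw [e2] at h
  rw [integral_add (integrable_poly_stdG _) (integrable_poly_stdG _)] at h
  simp only [Polynomial.eval_mul, Polynomial.eval_X] at h ⊢
  linarith

lemma heR_orth (l m : ℕ) :
    ∫ x, (heR l).eval x * (heR m).eval x ∂stdG = if l = m then (l.factorial : ℝ) else 0 := by
  induction l generalizing m with
  | zero =>
    cases m with
    | zero => simp [heR_zero]
    | succ m =>
      have := heR_ibp m 1
      simpa [heR_zero] using this
  | succ l ih =>
    cases m with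
    | zero =>
      have := heR_ibp l 1
      simpa [heR_zero] using this
    | succ m =>
      rw [heR_ibp, heR_deriv]
      have : ∀ x, (heR l).eval x * (((m : ℝ) + 1) • heR m).eval x
        = ((m : ℝ) + 1) * ((heR l).eval x * (heR m).eval x) := by
        intro x; simp; ring
      simp_rw [this]
      rw [integral_const_mul, ih]
      by_cases h : l = m
      · subst h; simp [Nat.factorial_succ]
      · simp [h]

lemma hermiteFn_orth (l m : ℕ) :
    ∫ x, hermiteFn l x * hermiteFn m x ∂stdG = if l = m then 1 else 0 := by
  have : ∀ x, hermiteFn l x * hermiteFn m x =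
      (Real.sqrt (Nat.factorial l) * Real.sqrt (Nat.factorial m))⁻¹ *
        ((heR l).eval x * (heR m).eval x) := by
    intro x; rw [hermiteFn_eq, hermiteFn_eq]; field_simp
  simp_rw [this]
  rw [integral_const_mul, heR_orth]
  by_cases h : l = m
  · subst h
    have : (0 : ℝ) < l.factorial := by positivity
    simp [Real.mul_self_sqrt this.le, this.ne']
  · simp [h]

lemma memLp_poly_stdG (q : Polynomial ℝ) : MemLp (fun x : ℝ => q.eval x) 2 stdG := by
  rw [memLp_two_iff_integrable_sq (integrable_poly_stdG q).aestronglyMeasurable]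
  exact (integrable_poly_stdG (q ^ 2)).congr (ae_of_all _ fun x => by simp)

lemma memLp_hermiteFn (l : ℕ) : MemLp (hermiteFn l) 2 stdG := by
  have : hermiteFn l = fun x => (Polynomial.C (Real.sqrt (Nat.factorial l))⁻¹ * heR l).eval x := by
    ext x; simp [hermiteFn_eq]; field_simp
  rw [this]
  exact memLp_poly_stdG _

/-- Mehler averaging -/
lemma heR_average (ρ σ : ℝ) (h : ρ ^ 2 + σ ^ 2 = 1) (l : ℕ) (s : ℝ) :
    ∫ z, (heR l).eval (ρ * s + σ * z) ∂stdG = ρ ^ l * (heR l).eval s := by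
  set w : Polynomial ℝ := Polynomial.C (ρ * s) + Polynomial.C σ * Polynomial.X with hw
  have hwe : ∀ (q : Polynomial ℝ) (z : ℝ), q.eval (ρ * s + σ * z) = (q.comp w).eval z := by
    intro q z; simp [hw, Polynomial.eval_comp]
  induction l using Nat.strong_induction_on with
  | _ l ih =>
    match l with
    | 0 => simp [heR_zero]
    | 1 =>
      have h0 : ∫ x, x ∂stdG = 0 := by simp [stdG]
      simp only [heR_one, Polynomial.eval_X, pow_one]
      rw [integral_add (integrable_const _) ((by simpa using integrable_pow_stdG 1 :
        Integrable (fun x : ℝ => x) stdG).const_mul σ), integral_const_mul σ, h0]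
      simp
    | (l + 2) =>
      have i1 := ih (l + 1) (by omega)
      have i0 := ih l (by omega)
      have e : ∀ z, (heR (l + 2)).eval (ρ * s + σ * z)
          = (ρ * s) * (heR (l + 1)).eval (ρ * s + σ * z)
            + σ * (z * ((heR (l + 1)).comp w).eval z)
            - ((l : ℝ) + 1) * (heR l).eval (ρ * s + σ * z) := by
        intro z
        rw [← hwe, heR_rec]
        simp
        ring
      have st := stein_poly ((heR (l + 1)).comp w)
      have e2 : ∀ z, ((heR (l + 1)).comp w).derivative.eval z
          = (σ * ((l : ℝ) + 1)) * (heR l).eval (ρ * s + σ * z) := by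
        intro z
        rw [Polynomial.derivative_comp, heR_deriv, hwe]
        simp [hw]
        ring
      simp_rw [e2] at st
      rw [integral_const_mul, i0] at st
      simp_rw [e]
      have j1 : Integrable (fun z => (heR (l + 1)).eval (ρ * s + σ * z)) stdG := by
        simp_rw [hwe]; exact integrable_poly_stdG _
      have j0 : Integrable (fun z => (heR l).eval (ρ * s + σ * z)) stdG := by
        simp_rw [hwe]; exact integrable_poly_stdG _
      have j2 : Integrable (fun z => z * ((heR (l + 1)).comp w).eval z) stdG := by
        exact (integrable_poly_stdG (Polynomial.X * ((heR (l + 1)).comp w))).congr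
          (ae_of_all _ fun x => by simp)
      have j12 : Integrable (fun z => (ρ * s) * (heR (l + 1)).eval (ρ * s + σ * z)
            + σ * (z * ((heR (l + 1)).comp w).eval z)) stdG :=
        (j1.const_mul _).add (j2.const_mul _)
      rw [integral_sub j12 (j0.const_mul _),
        integral_add (j1.const_mul _) (j2.const_mul _), integral_const_mul, integral_const_mul,
        integral_const_mul, i1, i0, st, heR_rec]
      have : σ ^ 2 = 1 - ρ ^ 2 := by linarith
      simp only [Polynomial.eval_sub, Polynomial.eval_mul, Polynomial.eval_X,
        Polynomial.eval_smul, smul_eq_mul]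
      linear_combination ((l:ℝ) + 1) * ρ ^ l * (heR l).eval s * this

lemma memLp_exp_abs_stdG (t : ℝ) : MemLp (fun x : ℝ => Real.exp (|t * x|)) 2 stdG := by
  rw [memLp_two_iff_integrable_sq (by fun_prop)]
  have h1 := integrable_exp_mul_gaussianReal (μ := 0) (v := 1) (2 * t)
  have h2 := integrable_exp_mul_gaussianReal (μ := 0) (v := 1) (-(2 * t))
  refine (h1.add h2).mono' (by fun_prop) (ae_of_all _ fun x => ?_)
  rw [Real.norm_of_nonneg (by positivity), ← Real.exp_nat_mul]
  simp only [Pi.add_apply]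
  rcases abs_cases (t * x) with h | h <;> rw [h.1]
  · have : ((2 : ℕ) : ℝ) * (t * x) = 2 * t * x := by push_cast; ring
    rw [this]; have := Real.exp_pos (-(2 * t) * x); linarith
  · have : ((2 : ℕ) : ℝ) * (-(t * x)) = -(2 * t) * x := by push_cast; ring
    rw [this]; have := Real.exp_pos ((2 * t) * x); linarith

lemma integral_pow_of_orth {f : ℝ → ℝ} (hf : MemLp f 2 stdG)
    (h : ∀ l, ∫ x, f x * (heR l).eval x ∂stdG = 0) (k l : ℕ) :
    ∫ x, f x * (x ^ k * (heR l).eval x) ∂stdG = 0 := by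
  have hIntg : ∀ q : Polynomial ℝ, Integrable (fun x => f x * q.eval x) stdG := fun q =>
    hf.integrable_mul (memLp_poly_stdG q)
  induction k generalizing l with
  | zero => simpa using h l
  | succ k ih =>
    cases l with
    | zero =>
      have := ih 1
      rw [heR_one] at this
      rw [heR_zero, ← this]
      congr 1; ext x; simp only [Polynomial.eval_one, Polynomial.eval_X]; ring
    | succ l =>
      have e : ∀ x, f x * (x ^ (k + 1) * (heR (l + 1)).eval x)
          = f x * (x ^ k * (heR (l + 2)).eval x)
            + ((l : ℝ) + 1) * (f x * (x ^ k * (heR l).eval x)) := by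
        intro x; rw [heR_rec]; simp; ring
      simp_rw [e]
      have hi : ∀ m, Integrable (fun x => f x * (x ^ k * (heR m).eval x)) stdG := fun m =>
        (hIntg (Polynomial.X ^ k * heR m)).congr (ae_of_all _ fun x => by simp)
      rw [integral_add (hi _) ((hi _).const_mul _), integral_const_mul, ih, ih]
      simp

lemma charFn_zero_of_orth {f : ℝ → ℝ} (hf : MemLp f 2 stdG)
    (h : ∀ l, ∫ x, f x * (heR l).eval x ∂stdG = 0) (t : ℝ) :
    ∫ x, (f x : ℂ) * Complex.exp (t * x * Complex.I) ∂stdG = 0 := by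
  have hp : ∀ k : ℕ, ∫ x, f x * x ^ k ∂stdG = 0 := fun k => by
    have := integral_pow_of_orth hf h k 0
    simpa [heR_zero] using this
  have key := hasSum_integral_of_dominated_convergence (μ := stdG)
    (F := fun (k : ℕ) (x : ℝ) => (f x : ℂ) * ((t * x * Complex.I) ^ k / (k.factorial : ℂ)))
    (f := fun x => (f x : ℂ) * Complex.exp (t * x * Complex.I))
    (bound := fun k x => |f x| * (|t * x| ^ k / k.factorial))
    (fun k => by
      have := hf.aestronglyMeasurable
      have h2 : AEStronglyMeasurable (fun x => (f x : ℂ)) stdG :=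
        Complex.continuous_ofReal.comp_aestronglyMeasurable this
      exact h2.mul (by fun_prop))
    (fun k => ae_of_all _ fun x => by
      simp [abs_mul])
    (ae_of_all _ fun x => (Real.summable_pow_div_factorial _).mul_left _)
    (by
      have : (fun x => ∑' k : ℕ, |f x| * (|t * x| ^ k / k.factorial))
          = fun x => |f x| * Real.exp |t * x| := by
        ext x
        rw [tsum_mul_left, Real.exp_eq_exp_ℝ, NormedSpace.exp_eq_tsum_div]
      rw [this]
      exact hf.abs.integrable_mul (memLp_exp_abs_stdG t))
    (ae_of_all _ fun x => by
      have := NormedSpace.expSeries_div_hasSum_exp (𝔸 := ℂ) (t * x * Complex.I)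
      rw [← Complex.exp_eq_exp_ℂ] at this
      exact this.mul_left _)
  have hz : ∀ k : ℕ, ∫ x, (f x : ℂ) * ((t * x * Complex.I) ^ k / (k.factorial : ℂ)) ∂stdG = 0 := by
    intro k
    have : ∀ x : ℝ, (f x : ℂ) * ((t * x * Complex.I) ^ k / (k.factorial : ℂ))
        = ((t * Complex.I) ^ k / (k.factorial : ℂ)) * ((f x * x ^ k : ℝ) : ℂ) := by
      intro x; push_cast; ring
    simp_rw [this]
    rw [integral_const_mul, integral_complex_ofReal, hp]
    simp
  simp_rw [hz] at key
  exact key.unique hasSum_zero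

lemma ae_zero_of_orth {f : ℝ → ℝ} (hfm : Measurable f) (hf : MemLp f 2 stdG)
    (h : ∀ l, ∫ x, f x * (heR l).eval x ∂stdG = 0) : f =ᵐ[stdG] 0 := by
  have hi : Integrable f stdG := hf.integrable (by norm_num)
  set g₁ : ℝ → ENNReal := fun x => ENNReal.ofReal (f x)
  set g₂ : ℝ → ENNReal := fun x => ENNReal.ofReal (- f x)
  have m1 : Measurable g₁ := by fun_prop
  have m2 : Measurable g₂ := by fun_prop
  have f1 : ∫⁻ x, g₁ x ∂stdG ≠ ⊤ := hi.lintegral_lt_top.ne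
  have f2 : ∫⁻ x, g₂ x ∂stdG ≠ ⊤ := hi.neg.lintegral_lt_top.ne
  have := isFiniteMeasure_withDensity f1
  have := isFiniteMeasure_withDensity f2
  have heq : stdG.withDensity g₁ = stdG.withDensity g₂ := by
    apply Measure.ext_of_charFun
    ext t
    rw [charFun_apply_real, charFun_apply_real,
      integral_withDensity_eq_integral_toReal_smul m1 (ae_of_all _ fun x => ENNReal.ofReal_lt_top),
      integral_withDensity_eq_integral_toReal_smul m2 (ae_of_all _ fun x => ENNReal.ofReal_lt_top),
      ← sub_eq_zero, ← integral_sub]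
    · rw [← charFn_zero_of_orth hf h t]
      congr 1; ext x
      rw [← sub_smul]
      simp only [g₁, g₂, ENNReal.toReal_ofReal']
      have : max (f x) 0 - max (-f x) 0 = f x := by
        rcases le_total 0 (f x) with h | h <;> simp [h]
      rw [this]; simp
    · have : Integrable (fun x => (g₁ x).toReal) stdG := integrable_toReal_of_lintegral_ne_top
        m1.aemeasurable f1
      refine (this.ofReal (𝕜 := ℂ)).mono (by fun_prop) (ae_of_all _ fun x => ?_)
      rw [norm_smul]
      have : ‖Complex.exp (t * x * Complex.I)‖ = 1 := by
        have := Complex.norm_exp_ofReal_mul_I (t * x); push_cast at this; exact this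
      rw [this]; simp
    · have : Integrable (fun x => (g₂ x).toReal) stdG := integrable_toReal_of_lintegral_ne_top
        m2.aemeasurable f2
      refine (this.ofReal (𝕜 := ℂ)).mono (by fun_prop) (ae_of_all _ fun x => ?_)
      rw [norm_smul]
      have : ‖Complex.exp (t * x * Complex.I)‖ = 1 := by
        have := Complex.norm_exp_ofReal_mul_I (t * x); push_cast at this; exact this
      rw [this]; simp
  have := (withDensity_eq_iff m1.aemeasurable m2.aemeasurable f1).1 heq
  filter_upwards [this] with x hx
  simp only [g₁, g₂] at hx
  rcases le_total 0 (f x) with h | h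
  · rw [ENNReal.ofReal_of_nonpos (by linarith : -f x ≤ 0), ENNReal.ofReal_eq_zero] at hx
    exact le_antisymm hx h
  · rw [ENNReal.ofReal_of_nonpos h, eq_comm, ENNReal.ofReal_eq_zero] at hx
    simp; linarith

/-- Hermite functions as elements of `L²`. -/
def hermL (l : ℕ) : Lp ℝ 2 stdG := (memLp_hermiteFn l).toLp

lemma inner_toLp_stdG {Ω : Type*} [MeasurableSpace Ω] {μ : Measure Ω} {f g : Ω → ℝ}
    (hf : MemLp f 2 μ) (hg : MemLp g 2 μ) :
    inner ℝ (hf.toLp) (hg.toLp) = ∫ x, f x * g x ∂μ := by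
  rw [L2.inner_def]
  refine integral_congr_ae ?_
  filter_upwards [hf.coeFn_toLp, hg.coeFn_toLp] with x h1 h2
  rw [h1, h2]; simp [mul_comm]

lemma hermL_orthonormal : Orthonormal ℝ hermL := by
  rw [orthonormal_iff_ite]
  intro i j
  rw [hermL, hermL, inner_toLp_stdG, hermiteFn_orth]

lemma hermL_complete : (Submodule.span ℝ (Set.range hermL))ᗮ = ⊥ := by
  rw [Submodule.eq_bot_iff]
  intro f hf
  have hf' : ∀ l, inner ℝ (hermL l) f = 0 := fun l =>
    (Submodule.mem_orthogonal _ _).1 hf _ (Submodule.subset_span ⟨l, rfl⟩)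
  obtain ⟨g, hgm, hfg⟩ := (Lp.aestronglyMeasurable f)
  have hg2 : MemLp g 2 stdG := (memLp_congr_ae hfg).1 (Lp.memLp f)
  have hfe : f = hg2.toLp := by
    rw [Lp.ext_iff]
    exact hfg.trans hg2.coeFn_toLp.symm
  have := ae_zero_of_orth hgm.measurable hg2 (fun l => by
    have h1 := hf' l
    rw [hfe, hermL, inner_toLp_stdG] at h1
    have e : ∀ x, g x * (heR l).eval x = Real.sqrt (Nat.factorial l) * (hermiteFn l x * g x) := by
      intro x; rw [hermiteFn_eq]
      have : (0 : ℝ) < l.factorial := by positivity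
      field_simp
    simp_rw [e]
    rw [integral_const_mul, h1, mul_zero])
  rw [Lp.eq_zero_iff_ae_eq_zero]
  exact hfg.trans this

def hermB : HilbertBasis ℕ ℝ (Lp ℝ 2 stdG) :=
  HilbertBasis.mkOfOrthogonalEqBot hermL_orthonormal hermL_complete

lemma hermB_apply (l : ℕ) : hermB l = hermL l := by
  simp [hermB]

/-- The law of a row. -/
abbrev rowG (d : ℕ) : Measure (Fin d → ℝ) :=
  Measure.pi fun _ => gaussianReal 0 ((d : NNReal))⁻¹

lemma continuous_dotp {d : ℕ} (w : Fin d → ℝ) : Continuous fun v : Fin d → ℝ => dotp v w := by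
  unfold dotp; fun_prop

lemma charRow {d : ℕ} (w : Fin d → ℝ) :
    ∫ v, Complex.exp ((dotp v w : ℝ) * Complex.I) ∂(rowG d)
      = Complex.exp (-(((∑ j, w j ^ 2) / d / 2 : ℝ) : ℂ)) := by
  have e : ∀ v : Fin d → ℝ, Complex.exp ((dotp v w : ℝ) * Complex.I)
      = ∏ j, Complex.exp (w j * v j * Complex.I) := by
    intro v
    rw [← Complex.exp_sum, dotp]
    congr 1
    push_cast
    rw [Finset.sum_mul]
    exact Finset.sum_congr rfl fun j _ => by ring
  simp_rw [e]
  rw [integral_fintype_prod_eq_prod (𝕜 := ℂ) (fun j (z : ℝ) => Complex.exp (w j * z * Complex.I))]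
  have : ∀ j, ∫ z : ℝ, Complex.exp (w j * z * Complex.I) ∂(gaussianReal 0 ((d : NNReal))⁻¹)
      = Complex.exp (-((w j ^ 2 / d / 2 : ℝ) : ℂ)) := by
    intro j
    rw [← charFun_apply_real, charFun_gaussianReal]
    congr 1
    push_cast
    ring
  simp_rw [this]
  rw [← Complex.exp_sum]
  congr 1
  push_cast
  rw [Finset.sum_neg_distrib, Finset.sum_div, Finset.sum_div]

lemma map_dotp {d : ℕ} (x : Fin d → ℝ) (hd : 0 < d) (hx : ∑ j, x j ^ 2 = d) :
    MeasurePreserving (fun v : Fin d → ℝ => dotp v x) (rowG d) stdG := by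
  refine ⟨(continuous_dotp x).measurable, ?_⟩
  have := Measure.isProbabilityMeasure_map (μ := rowG d) (continuous_dotp x).measurable.aemeasurable
  apply Measure.ext_of_charFun
  ext t
  rw [charFun_apply_real, charFun_gaussianReal,
    integral_map (continuous_dotp x).measurable.aemeasurable (by fun_prop)]
  have h := charRow (fun j => t * x j)
  have e : ∀ v : Fin d → ℝ, ((dotp v (fun j => t * x j) : ℝ) : ℂ) = t * dotp v x := by
    intro v
    rw [← Complex.ofReal_mul]
    congr 1
    rw [dotp, dotp, Finset.mul_sum]
    exact Finset.sum_congr rfl fun j _ => by ring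
  simp_rw [e] at h
  rw [h]
  congr 1
  simp_rw [mul_pow]
  rw [← Finset.mul_sum, hx]
  have : (d : ℝ) ≠ 0 := by positivity
  rw [mul_div_assoc, div_self this]
  push_cast
  ring

lemma map_dotp_pair {d : ℕ} (x y : Fin d → ℝ) (hd : 0 < d) (hx : ∑ j, x j ^ 2 = d)
    (hy : ∑ j, y j ^ 2 = d) (σ : ℝ) (hσ : (dotp x y / d) ^ 2 + σ ^ 2 = 1) :
    (rowG d).map (fun v => (dotp v x, dotp v y))
      = (stdG.prod stdG).map (fun q => (q.1, dotp x y / d * q.1 + σ * q.2)) := by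
  have m1 : Measurable (fun v : Fin d → ℝ => (dotp v x, dotp v y)) :=
    ((continuous_dotp x).prodMk (continuous_dotp y)).measurable
  have m2 : Measurable (fun q : ℝ × ℝ => (q.1, dotp x y / d * q.1 + σ * q.2)) := by fun_prop
  have := Measure.isProbabilityMeasure_map (μ := rowG d) m1.aemeasurable
  have := Measure.isProbabilityMeasure_map (μ := stdG.prod stdG) m2.aemeasurable
  apply Measure.ext_of_charFunDual
  ext L
  rw [charFunDual_apply, charFunDual_apply, integral_map m1.aemeasurable (by fun_prop),
    integral_map m2.aemeasurable (by fun_prop)]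
  set α := L (1, 0) with hα
  set β := L (0, 1) with hβ
  have hL : ∀ a b : ℝ, L (a, b) = α * a + β * b := by
    intro a b
    have : (a, b) = a • ((1 : ℝ), (0 : ℝ)) + b • ((0 : ℝ), (1 : ℝ)) := by simp
    rw [this, map_add, map_smul, map_smul]
    simp only [smul_eq_mul]; rw [← hα, ← hβ]; ring
  simp_rw [hL]
  have h := charRow (fun j => α * x j + β * y j)
  have e : ∀ v : Fin d → ℝ, dotp v (fun j => α * x j + β * y j) = α * dotp v x + β * dotp v y := by
    intro v
    rw [dotp, dotp, dotp, Finset.mul_sum, Finset.mul_sum, ← Finset.sum_add_distrib]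
    exact Finset.sum_congr rfl fun j _ => by ring
  simp_rw [e] at h
  rw [h]
  set ρ := dotp x y / d with hρ
  have e2 : ∀ q : ℝ × ℝ, Complex.exp (((α * q.1 + β * (ρ * q.1 + σ * q.2) : ℝ) : ℂ) * Complex.I)
      = Complex.exp (((α + β * ρ : ℝ) : ℂ) * q.1 * Complex.I)
        * Complex.exp (((β * σ : ℝ) : ℂ) * q.2 * Complex.I) := by
    intro q
    rw [← Complex.exp_add]
    congr 1
    push_cast
    ring
  simp_rw [e2]
  rw [integral_prod_mul (fun s : ℝ => Complex.exp (((α + β * ρ : ℝ) : ℂ) * s * Complex.I))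
    (fun s : ℝ => Complex.exp (((β * σ : ℝ) : ℂ) * s * Complex.I)),
    ← charFun_apply_real, ← charFun_apply_real, charFun_gaussianReal, charFun_gaussianReal,
    ← Complex.exp_add]
  congr 1
  have hd' : (d : ℝ) ≠ 0 := by positivity
  have e3 : (∑ j, (α * x j + β * y j) ^ 2) / d = α ^ 2 + 2 * α * β * ρ + β ^ 2 := by
    have : (∑ j, (α * x j + β * y j) ^ 2)
        = α ^ 2 * ∑ j, x j ^ 2 + 2 * α * β * dotp x y + β ^ 2 * ∑ j, y j ^ 2 := by
      rw [dotp, Finset.mul_sum, Finset.mul_sum, Finset.mul_sum, ← Finset.sum_add_distrib,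
        ← Finset.sum_add_distrib]
      exact Finset.sum_congr rfl fun j _ => by ring
    rw [this, hx, hy, hρ]
    field_simp
  rw [e3]
  have : σ ^ 2 = 1 - ρ ^ 2 := by linarith
  have e4 : α ^ 2 + 2 * α * β * ρ + β ^ 2 = (α + β * ρ) ^ 2 + (β * σ) ^ 2 := by
    rw [mul_pow, this]; ring
  rw [e4]
  push_cast
  ring

lemma abs_dotp_div_le {d : ℕ} (x y : Fin d → ℝ) (hd : 0 < d) (hx : ∑ j, x j ^ 2 = d)
    (hy : ∑ j, y j ^ 2 = d) : (dotp x y / d) ^ 2 ≤ 1 := by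
  have := Finset.sum_mul_sq_le_sq_mul_sq Finset.univ x y
  rw [hx, hy] at this
  have hd' : (0 : ℝ) < d := by positivity
  rw [div_pow, div_le_one (by positivity)]
  rw [dotp]; nlinarith

lemma integral_mul_hermite {d : ℕ} (x y : Fin d → ℝ) (hd : 0 < d) (hx : ∑ j, x j ^ 2 = d)
    (hy : ∑ j, y j ^ 2 = d) (f : ℝ → ℝ) (hfm : Measurable f) (hf : MemLp f 2 stdG) (l : ℕ) :
    ∫ v, f (dotp v x) * hermiteFn l (dotp v y) ∂(rowG d)
      = (dotp x y / d) ^ l * hermiteCoeff f l := by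
  have hρ := abs_dotp_div_le x y hd hx hy
  set σ := Real.sqrt (1 - (dotp x y / d) ^ 2) with hσd
  have hσ : (dotp x y / d) ^ 2 + σ ^ 2 = 1 := by
    rw [hσd, Real.sq_sqrt (by linarith)]; ring
  have hlaw := map_dotp_pair x y hd hx hy σ hσ
  set ρ := dotp x y / d with hρd
  have hhm : Measurable (hermiteFn l) := by
    have : hermiteFn l = fun x => (heR l).eval x / Real.sqrt (Nat.factorial l) := by
      ext x; rw [hermiteFn_eq]
    rw [this]; exact ((heR l).continuous.measurable).div_const _
  have m1 : Measurable (fun v : Fin d → ℝ => (dotp v x, dotp v y)) :=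
    ((continuous_dotp x).prodMk (continuous_dotp y)).measurable
  have m2 : Measurable (fun q : ℝ × ℝ => (q.1, ρ * q.1 + σ * q.2)) := by fun_prop
  have mF : Measurable (fun q : ℝ × ℝ => f q.1 * hermiteFn l q.2) := by fun_prop
  have hIntg : Integrable (fun v => f (dotp v x) * hermiteFn l (dotp v y)) (rowG d) :=
    (hf.comp_measurePreserving (map_dotp x hd hx)).integrable_mul
      ((memLp_hermiteFn l).comp_measurePreserving (map_dotp y hd hy))
  have hint2 : Integrable (fun q : ℝ × ℝ => f q.1 * hermiteFn l (ρ * q.1 + σ * q.2))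
      (stdG.prod stdG) := by
    have h1 : Integrable (fun q : ℝ × ℝ => f q.1 * hermiteFn l q.2)
        ((rowG d).map (fun v => (dotp v x, dotp v y))) :=
      (integrable_map_measure mF.aestronglyMeasurable m1.aemeasurable).2 hIntg
    rw [hlaw] at h1
    exact (integrable_map_measure mF.aestronglyMeasurable m2.aemeasurable).1 h1
  have h1 : ∫ v, f (dotp v x) * hermiteFn l (dotp v y) ∂(rowG d)
      = ∫ q, f q.1 * hermiteFn l q.2 ∂((rowG d).map (fun v => (dotp v x, dotp v y))) :=
    (integral_map m1.aemeasurable mF.aestronglyMeasurable).symm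
  rw [h1, hlaw, integral_map m2.aemeasurable mF.aestronglyMeasurable]
  simp only
  rw [integral_prod _ hint2, hermiteCoeff, ← integral_const_mul]
  congr 1
  ext s
  simp only
  rw [integral_const_mul]
  simp_rw [hermiteFn_eq]
  rw [integral_div, heR_average ρ σ hσ]
  ring

/-- Mehler formula for correlated Gaussians. -/
lemma mehler {d : ℕ} (x y : Fin d → ℝ) (hd : 0 < d) (hx : ∑ j, x j ^ 2 = d)
    (hy : ∑ j, y j ^ 2 = d) (f g : ℝ → ℝ) (hfm : Measurable f) (hf : MemLp f 2 stdG)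
    (hg : MemLp g 2 stdG) :
    HasSum (fun l => hermiteCoeff f l * hermiteCoeff g l * (dotp x y / d) ^ l)
      (∫ v, f (dotp v x) * g (dotp v y) ∂(rowG d)) := by
  set Ix := Lp.compMeasurePreservingₗᵢ (E := ℝ) (p := 2) ℝ _ (map_dotp x hd hx)
  set Iy := Lp.compMeasurePreservingₗᵢ (E := ℝ) (p := 2) ℝ _ (map_dotp y hd hy)
  have hs := hermB.hasSum_repr hg.toLp
  have hs2 := hs.mapL ((innerSL ℝ (Ix hf.toLp)).comp Iy.toContinuousLinearMap)
  have hcx := hf.comp_measurePreserving (map_dotp x hd hx)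
  have hcy := hg.comp_measurePreserving (map_dotp y hd hy)
  have e1 : Ix hf.toLp = hcx.toLp := rfl
  have e2 : Iy hg.toLp = hcy.toLp := rfl
  have e3 : ∀ l, Iy (hermL l)
    = ((memLp_hermiteFn l).comp_measurePreserving (map_dotp y hd hy)).toLp := fun l => rfl
  have t1 : ((innerSL ℝ (Ix hf.toLp)).comp Iy.toContinuousLinearMap) hg.toLp
      = ∫ v, f (dotp v x) * g (dotp v y) ∂(rowG d) := by
    simp only [ContinuousLinearMap.comp_apply, LinearIsometry.coe_toContinuousLinearMap,
      innerSL_apply_apply]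
    rw [e1, e2, inner_toLp_stdG]
    rfl
  rw [t1] at hs2
  have key : ∀ l, ((innerSL ℝ (Ix hf.toLp)).comp Iy.toContinuousLinearMap)
      (hermB.repr hg.toLp l • hermB l)
      = hermiteCoeff f l * hermiteCoeff g l * (dotp x y / d) ^ l := by
    intro l
    rw [map_smul, smul_eq_mul, HilbertBasis.repr_apply_apply, hermB_apply]
    simp only [ContinuousLinearMap.comp_apply, LinearIsometry.coe_toContinuousLinearMap,
        innerSL_apply_apply]
    rw [e1, e3, inner_toLp_stdG, hermL, inner_toLp_stdG]
    have := integral_mul_hermite x y hd hx hy f hfm hf l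
    simp only [Function.comp_apply]
    rw [this]
    have e5 : ∫ z, hermiteFn l z * g z ∂stdG = hermiteCoeff g l := by
      rw [hermiteCoeff]; congr 1; ext z; ring
    rw [e5]; ring
  simp_rw [key] at hs2
  exact hs2

/-- The scalar nonlinear part. -/
def tphi (φ : ℝ → ℝ) (z : ℝ) : ℝ := φ z - hermiteCoeff φ 1 * z

lemma tphi_growth {φ : ℝ → ℝ} (hφ : ActivationAssumptionCore φ) :
    ∃ B : ℝ, 1 ≤ B ∧ ∀ z, |tphi φ z| ≤ B * (1 + |z|) := by
  obtain ⟨L, hL⟩ := hφ.lipschitz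
  refine ⟨1 + |φ 0| + L + |hermiteCoeff φ 1|, ?_, ?_⟩
  · have := abs_nonneg (φ 0); have := abs_nonneg (hermiteCoeff φ 1); have := L.2
    have : (0:ℝ) ≤ L := L.2
    linarith
  · intro z
    have h := hL.dist_le_mul z 0
    rw [Real.dist_eq, Real.dist_eq, sub_zero] at h
    have h1 : |φ z| ≤ |φ 0| + L * |z| := by
      have := abs_sub_abs_le_abs_sub (φ z) (φ 0); linarith
    have h2 : |tphi φ z| ≤ |φ z| + |hermiteCoeff φ 1| * |z| := by
      unfold tphi; rw [← abs_mul]; exact abs_sub _ _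
    have h3 : (0:ℝ) ≤ L := L.2
    have := abs_nonneg (φ 0); have := abs_nonneg (hermiteCoeff φ 1); have := abs_nonneg z
    nlinarith [mul_nonneg (abs_nonneg (φ 0)) (abs_nonneg z)]

lemma tphi_continuous {φ : ℝ → ℝ} (hφ : ActivationAssumptionCore φ) : Continuous (tphi φ) := by
  have := hφ.differentiable.continuous
  unfold tphi; fun_prop

lemma memLp_id_stdG : MemLp (fun z : ℝ => z) 2 stdG := by
  have := memLp_poly_stdG Polynomial.X
  simp only [Polynomial.eval_X] at this
  exact this

lemma memLp_tphi {φ : ℝ → ℝ} (hφ : ActivationAssumptionCore φ) : MemLp (tphi φ) 2 stdG := by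
  obtain ⟨B, hB, h⟩ := tphi_growth hφ
  have h1 : MemLp (fun z : ℝ => B * (1 + |z|)) 2 stdG := by
    have a : MemLp (fun z : ℝ => |z|) 2 stdG := memLp_id_stdG.norm
    exact ((memLp_const (1:ℝ)).add a).const_mul B
  refine h1.mono (tphi_continuous hφ).aestronglyMeasurable (ae_of_all _ fun z => ?_)
  rw [Real.norm_eq_abs, Real.norm_eq_abs]
  exact (h z).trans (le_abs_self _)

lemma hermiteFn_one (z : ℝ) : hermiteFn 1 z = z := by
  rw [hermiteFn_eq, heR_one]; simp

lemma hermiteCoeff_id (l : ℕ) : hermiteCoeff (fun z => z) l = if l = 1 then 1 else 0 := by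
  have := hermiteFn_orth 1 l
  simp_rw [hermiteFn_one] at this
  rw [hermiteCoeff, this]
  simp [eq_comm]

lemma hermiteCoeff_tphi {φ : ℝ → ℝ} (hφ : ActivationAssumptionCore φ) (l : ℕ) :
    hermiteCoeff (tphi φ) l = if 3 ≤ l then hermiteCoeff φ l else 0 := by
  have i1 : Integrable (fun z => tphi φ z * hermiteFn l z) stdG :=
    (memLp_tphi hφ).integrable_mul (memLp_hermiteFn l)
  have i2 : Integrable (fun z => hermiteCoeff φ 1 * (z * hermiteFn l z)) stdG :=
    (memLp_id_stdG.integrable_mul (memLp_hermiteFn l)).const_mul _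
  have e : hermiteCoeff φ l = hermiteCoeff (tphi φ) l
      + hermiteCoeff φ 1 * hermiteCoeff (fun z => z) l := by
    rw [hermiteCoeff, hermiteCoeff.eq_1 (tphi φ), hermiteCoeff.eq_1 (fun z => z),
      ← integral_const_mul, ← integral_add i1 i2]
    congr 1; ext z; unfold tphi; ring
  rw [hermiteCoeff_id] at e
  rcases Nat.lt_or_ge l 3 with h | h
  · rw [if_neg (by omega)]
    interval_cases l
    · have := hφ.mu0; simp at e; linarith
    · simp at e; linarith
    · have := hφ.mu2; simp at e; linarith
  · rw [if_pos h]
    rw [if_neg (by omega)] at e; linarith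

lemma tmu2_hasSum {φ : ℝ → ℝ} (hφ : ActivationAssumptionCore φ) :
    HasSum (fun l => hermiteCoeff (tphi φ) l ^ 2) (tmu2 φ) := by
  have h := mehler (d := 1) (fun _ => 1) (fun _ => 1) one_pos (by simp) (by simp) (tphi φ) (tphi φ)
    (tphi_continuous hφ).measurable (memLp_tphi hφ) (memLp_tphi hφ)
  have e : ∀ l : ℕ, hermiteCoeff (tphi φ) l * hermiteCoeff (tphi φ) l *
      (dotp (fun _ : Fin 1 => (1:ℝ)) (fun _ => 1) / (1 : ℕ)) ^ l = hermiteCoeff (tphi φ) l ^ 2 := by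
    intro l; simp [dotp]; ring
  simp_rw [e] at h
  have e2 : tmu2 φ = ∑' l, hermiteCoeff (tphi φ) l ^ 2 := by
    rw [tmu2]; congr 1; ext l; rw [hermiteCoeff_tphi hφ]; split_ifs <;> simp
  rw [e2]; exact h.summable.hasSum

lemma tmu2_nonneg (φ : ℝ → ℝ) : 0 ≤ tmu2 φ :=
  tsum_nonneg fun l => by split_ifs <;> positivity

/-- expected self correlation -/
lemma mean_self {φ : ℝ → ℝ} (hφ : ActivationAssumptionCore φ) {d : ℕ} (x : Fin d → ℝ)
    (hd : 0 < d) (hx : ∑ j, x j ^ 2 = d) :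
    ∫ v, tphi φ (dotp v x) * tphi φ (dotp v x) ∂(rowG d) = tmu2 φ := by
  have h := mehler x x hd hx hx (tphi φ) (tphi φ)
    (tphi_continuous hφ).measurable (memLp_tphi hφ) (memLp_tphi hφ)
  have hd' : (d : ℝ) ≠ 0 := by positivity
  have e0 : dotp x x / d = 1 := by
    rw [dotp]; simp_rw [← pow_two]; rw [hx, div_self hd']
  rw [e0] at h
  have e : ∀ l : ℕ, hermiteCoeff (tphi φ) l * hermiteCoeff (tphi φ) l * 1 ^ l
      = hermiteCoeff (tphi φ) l ^ 2 := by
    intro l; simp; ring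
  simp_rw [e] at h
  exact h.unique (tmu2_hasSum hφ)

lemma mean_cross {φ : ℝ → ℝ} (hφ : ActivationAssumptionCore φ) {d : ℕ} (x y : Fin d → ℝ)
    (hd : 0 < d) (hx : ∑ j, x j ^ 2 = d) (hy : ∑ j, y j ^ 2 = d) :
    |∫ v, tphi φ (dotp v x) * tphi φ (dotp v y) ∂(rowG d)| ≤ tmu2 φ * |dotp x y / d| ^ 3 := by
  have h := mehler x y hd hx hy (tphi φ) (tphi φ)
    (tphi_continuous hφ).measurable (memLp_tphi hφ) (memLp_tphi hφ)
  have hρ := abs_dotp_div_le x y hd hx hy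
  have hρ' : |dotp x y / d| ≤ 1 := by rwa [← sq_le_one_iff_abs_le_one]
  have h2 := (tmu2_hasSum hφ).mul_right (|dotp x y / d| ^ 3)
  rw [← h.tsum_eq, ← h2.tsum_eq, ← Real.norm_eq_abs]
  refine tsum_of_norm_bounded h2.summable.hasSum fun l => ?_
  rw [norm_mul, norm_pow, Real.norm_eq_abs, Real.norm_eq_abs, ← pow_two, abs_of_nonneg (sq_nonneg _)]
  rcases Nat.lt_or_ge l 3 with h | h
  · rw [hermiteCoeff_tphi hφ, if_neg (by omega)]; simp
  · exact mul_le_mul_of_nonneg_left (pow_le_pow_of_le_one (abs_nonneg _) hρ' h) (sq_nonneg _)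

lemma mean_lin {φ : ℝ → ℝ} (hφ : ActivationAssumptionCore φ) {d : ℕ} (x y : Fin d → ℝ)
    (hd : 0 < d) (hx : ∑ j, x j ^ 2 = d) (hy : ∑ j, y j ^ 2 = d) :
    ∫ v, tphi φ (dotp v x) * dotp v y ∂(rowG d) = 0 := by
  have h := mehler x y hd hx hy (tphi φ) (fun z => z)
    (tphi_continuous hφ).measurable (memLp_tphi hφ) memLp_id_stdG
  have e : ∀ l : ℕ, hermiteCoeff (tphi φ) l * hermiteCoeff (fun z => z) l * (dotp x y / d) ^ l = 0 := by
    intro l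
    rw [hermiteCoeff_tphi hφ, hermiteCoeff_id]
    by_cases h : 3 ≤ l
    · have : l ≠ 1 := by omega
      simp [this]
    · rw [if_neg h]; simp
  simp_rw [e] at h
  exact h.unique hasSum_zero

lemma exp_le_quad (x : ℝ) : Real.exp x ≤ 1 + x + x ^ 2 * Real.exp |x| := by
  have h := Complex.norm_exp_sub_sum_le_norm_mul_exp (x : ℂ) 2
  simp only [Finset.sum_range_succ, Finset.sum_range_zero, Nat.factorial] at h
  have e : Complex.exp x - (0 + (x : ℂ) ^ 0 / ((1 : ℕ) : ℂ) + (x : ℂ) ^ 1 / (((0 + 1) * 1 : ℕ) : ℂ))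
      = ((Real.exp x - (1 + x) : ℝ) : ℂ) := by
    push_cast; simp
  rw [e, Complex.norm_real, Complex.norm_real, Real.norm_eq_abs, Real.norm_eq_abs, sq_abs] at h
  have := le_abs_self (Real.exp x - (1 + x))
  linarith

lemma mgf_bound {Ω : Type*} [MeasurableSpace Ω] (ν : Measure Ω) [IsProbabilityMeasure ν]
    (F : Ω → ℝ) (hF : Measurable F) (θ M : ℝ) (hθ : 0 < θ)
    (hi : Integrable (fun ω => Real.exp (θ * |F ω|)) ν) (hM : ∫ ω, Real.exp (θ * |F ω|) ∂ν ≤ M)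
    (t : ℝ) (ht : |t| ≤ θ / 2) :
    Integrable (fun ω => Real.exp (t * F ω)) ν ∧
    ∫ ω, Real.exp (t * F ω) ∂ν ≤ Real.exp (t * ∫ ω, F ω ∂ν + 8 * M / θ ^ 2 * t ^ 2) := by
  have key : ∀ ω, t ^ 2 * F ω ^ 2 * Real.exp |t * F ω| ≤ 8 / θ ^ 2 * t ^ 2 * Real.exp (θ * |F ω|) := by
    intro ω
    have h1 : θ ^ 2 / 8 * F ω ^ 2 ≤ Real.exp (θ / 2 * |F ω|) := by
      have := Real.quadratic_le_exp_of_nonneg (x := θ / 2 * |F ω|) (by positivity)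
      have h2 : (θ / 2 * |F ω|) ^ 2 = θ ^ 2 / 4 * F ω ^ 2 := by rw [mul_pow, sq_abs]; ring
      have h3 : 0 ≤ θ / 2 * |F ω| := by positivity
      nlinarith
    have h2 : Real.exp |t * F ω| ≤ Real.exp (θ / 2 * |F ω|) := by
      rw [abs_mul]; exact Real.exp_le_exp.2 (mul_le_mul_of_nonneg_right ht (abs_nonneg _))
    have h3 : Real.exp (θ * |F ω|) = Real.exp (θ / 2 * |F ω|) * Real.exp (θ / 2 * |F ω|) := by
      rw [← Real.exp_add]; congr 1; ring
    have h4 : F ω ^ 2 ≤ 8 / θ ^ 2 * Real.exp (θ / 2 * |F ω|) := by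
      rw [div_mul_eq_mul_div, le_div_iff₀ (by positivity)]; linarith
    rw [h3]
    calc t ^ 2 * F ω ^ 2 * Real.exp |t * F ω|
        ≤ t ^ 2 * (8 / θ ^ 2 * Real.exp (θ / 2 * |F ω|)) * Real.exp (θ / 2 * |F ω|) := by gcongr
      _ = _ := by ring
  have iF : Integrable F ν := by
    refine (hi.const_mul (1 / θ)).mono hF.aestronglyMeasurable (ae_of_all _ fun ω => ?_)
    rw [Real.norm_eq_abs]
    refine le_trans ?_ (le_abs_self _)
    rw [div_mul_eq_mul_div, one_mul, le_div_iff₀ hθ]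
    have := Real.add_one_le_exp (θ * |F ω|); linarith
  have iE : Integrable (fun ω => Real.exp (t * F ω)) ν := by
    refine hi.mono (by fun_prop) (ae_of_all _ fun ω => ?_)
    rw [Real.norm_eq_abs, Real.norm_eq_abs, Real.abs_exp, Real.abs_exp]
    apply Real.exp_le_exp.2
    calc t * F ω ≤ |t * F ω| := le_abs_self _
      _ = |t| * |F ω| := abs_mul _ _
      _ ≤ θ * |F ω| := mul_le_mul_of_nonneg_right (by linarith) (abs_nonneg _)
  refine ⟨iE, ?_⟩
  have i1 : Integrable (fun ω => 1 + t * F ω) ν := (integrable_const _).add (iF.const_mul t)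
  have i2 : Integrable (fun ω => 8 / θ ^ 2 * t ^ 2 * Real.exp (θ * |F ω|)) ν := hi.const_mul _
  have i3 : Integrable (fun ω => t * F ω) ν := iF.const_mul t
  calc ∫ ω, Real.exp (t * F ω) ∂ν
      ≤ ∫ ω, ((1 + t * F ω) + 8 / θ ^ 2 * t ^ 2 * Real.exp (θ * |F ω|)) ∂ν := by
        refine integral_mono iE (i1.add i2) fun ω => ?_
        have := exp_le_quad (t * F ω)
        rw [mul_pow] at this
        have := key ω
        simp only; linarith
    _ = 1 + t * ∫ ω, F ω ∂ν + 8 / θ ^ 2 * t ^ 2 * ∫ ω, Real.exp (θ * |F ω|) ∂ν := by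
        rw [integral_add i1 i2, integral_add (integrable_const _) i3, integral_const_mul,
          integral_const_mul]; simp
    _ ≤ 1 + t * ∫ ω, F ω ∂ν + 8 / θ ^ 2 * t ^ 2 * M := by gcongr
    _ = (t * ∫ ω, F ω ∂ν + 8 * M / θ ^ 2 * t ^ 2) + 1 := by ring
    _ ≤ _ := Real.add_one_le_exp _

lemma bernstein_one {Ω : Type*} [MeasurableSpace Ω] (ν : Measure Ω) [IsProbabilityMeasure ν]
    (F : Ω → ℝ) (hF : Measurable F) (θ M : ℝ) (hθ : 0 < θ)
    (hi : Integrable (fun ω => Real.exp (θ * |F ω|)) ν) (hM : ∫ ω, Real.exp (θ * |F ω|) ∂ν ≤ M)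
    (p : ℕ) (hp : 0 < p) (L : ℝ) (hL : 0 ≤ L) (hLp : L ≤ θ / 2 * Real.sqrt p) :
    (Measure.pi fun _ : Fin p => ν).real
      {V | (8 * M / θ ^ 2 + 1) * Real.sqrt p * L ≤ ∑ k, F (V k) - p * ∫ ω, F ω ∂ν}
      ≤ Real.exp (-L ^ 2) := by
  have hp' : (0:ℝ) < p := by positivity
  have hs : 0 < Real.sqrt p := Real.sqrt_pos.2 hp'
  have hss : Real.sqrt p ^ 2 = p := Real.sq_sqrt hp'.le
  set t := L / Real.sqrt p with ht
  have ht0 : 0 ≤ t := by positivity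
  have ht1 : |t| ≤ θ / 2 := by rw [abs_of_nonneg ht0, ht, div_le_iff₀ hs]; exact hLp
  obtain ⟨iE, hE⟩ := mgf_bound ν F hF θ M hθ hi hM t ht1
  set m := ∫ ω, F ω ∂ν
  set A := 8 * M / θ ^ 2
  have e : ∀ V : Fin p → Ω, Real.exp (t * ∑ k, F (V k)) = ∏ k, Real.exp (t * F (V k)) := by
    intro V; rw [← Real.exp_sum, Finset.mul_sum]
  have i1 : Integrable (fun V : Fin p → Ω => Real.exp (t * ∑ k, F (V k))) (Measure.pi fun _ => ν) := by
    simp_rw [e]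
    exact Integrable.fintype_prod (f := fun _ ω => Real.exp (t * F ω)) fun _ => iE
  have h := measure_ge_le_exp_mul_mgf (μ := Measure.pi fun _ : Fin p => ν)
    (X := fun V => ∑ k, F (V k)) ((A + 1) * Real.sqrt p * L + p * m) ht0 i1
  have hset : {V : Fin p → Ω | (A + 1) * Real.sqrt p * L ≤ ∑ k, F (V k) - p * m}
      = {V | (A + 1) * Real.sqrt p * L + p * m ≤ ∑ k, F (V k)} := by
    ext V; simp only [Set.mem_ofPred_eq]; constructor <;> intro h <;> linarith
  rw [hset]
  refine h.trans ?_
  rw [mgf]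
  simp_rw [e]
  rw [integral_fintype_prod_eq_pow (𝕜 := ℝ) (fun ω => Real.exp (t * F ω)), Fintype.card_fin]
  calc Real.exp (-t * ((A + 1) * Real.sqrt p * L + p * m)) * (∫ ω, Real.exp (t * F ω) ∂ν) ^ p
      ≤ Real.exp (-t * ((A + 1) * Real.sqrt p * L + p * m)) *
        (Real.exp (t * m + A * t ^ 2)) ^ p := by
        gcongr
    _ = Real.exp (-L ^ 2) := by
        rw [← Real.exp_nat_mul, ← Real.exp_add]
        congr 1
        have h1 : t * Real.sqrt p = L := by rw [ht]; field_simp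
        have h2 : t ^ 2 * p = L ^ 2 := by rw [← h1, mul_pow, hss]
        have h3 : t * ((A + 1) * Real.sqrt p * L) = (A + 1) * L ^ 2 := by
          calc _ = (A + 1) * (t * Real.sqrt p) * L := by ring
            _ = _ := by rw [h1]; ring
        linear_combination (-1) * h3 + A * h2

lemma bernstein_two {Ω : Type*} [MeasurableSpace Ω] (ν : Measure Ω) [IsProbabilityMeasure ν]
    (F : Ω → ℝ) (hF : Measurable F) (θ M : ℝ) (hθ : 0 < θ)
    (hi : Integrable (fun ω => Real.exp (θ * |F ω|)) ν) (hM : ∫ ω, Real.exp (θ * |F ω|) ∂ν ≤ M)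
    (p : ℕ) (hp : 0 < p) (L : ℝ) (hL : 0 ≤ L) (hLp : L ≤ θ / 2 * Real.sqrt p) :
    (Measure.pi fun _ : Fin p => ν)
      {V | (8 * M / θ ^ 2 + 1) * Real.sqrt p * L ≤ |∑ k, F (V k) - p * ∫ ω, F ω ∂ν|}
      ≤ ENNReal.ofReal (2 * Real.exp (-L ^ 2)) := by
  have h1 := bernstein_one ν F hF θ M hθ hi hM p hp L hL hLp
  have h2 := bernstein_one ν (fun ω => -F ω) hF.neg θ M hθ (by simpa using hi) (by simpa using hM)
    p hp L hL hLp
  rw [ENNReal.le_ofReal_iff_toReal_le (measure_ne_top _ _) (by positivity)]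
  change (Measure.pi fun _ : Fin p => ν).real _ ≤ _
  refine (measureReal_mono (s₂ := _ ∪ _) ?_ (measure_ne_top _ _)).trans
    ((measureReal_union_le _ _).trans ((add_le_add h1 h2).trans (by linarith)))
  intro V hV
  rw [Set.mem_ofPred_eq] at hV
  rcases le_abs.1 hV with h | h
  · left; exact h
  · right
    rw [Set.mem_ofPred_eq, integral_neg, Finset.sum_neg_distrib]; linarith

lemma integrable_exp_sq_stdG : Integrable (fun z : ℝ => Real.exp (z ^ 2 / 4)) stdG := by
  rw [integrable_stdG_iff]
  refine ((integrable_exp_neg_mul_sq (b := 1 / 4) (by norm_num)).const_mul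
    (Real.sqrt (2 * Real.pi * (1 : NNReal)))⁻¹).congr (ae_of_all _ fun z => ?_)
  simp only
  rw [gaussianPDFReal, mul_assoc (√(2 * Real.pi * ((1 : NNReal) : ℝ)))⁻¹, ← Real.exp_add]; congr 2; push_cast; ring

/-- Concentration for products of features. -/
lemma feat_conc (B : ℝ) (hB : 1 ≤ B) : ∃ C₁ : ℝ, 0 < C₁ ∧ ∃ c₁ : ℝ, 0 < c₁ ∧
    ∀ (f g : ℝ → ℝ), Measurable f → Measurable g → (∀ z, |f z| ≤ B * (1 + |z|)) →
    (∀ z, |g z| ≤ B * (1 + |z|)) → ∀ (d p : ℕ), 0 < d → 0 < p → ∀ L : ℝ, 0 ≤ L →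
    L ≤ c₁ * Real.sqrt p → ∀ x y : Fin d → ℝ, ∑ j, x j ^ 2 = d → ∑ j, y j ^ 2 = d →
    (gaussianMatrix p d) {V | C₁ * Real.sqrt p * L ≤
        |∑ k, f (dotp (V k) x) * g (dotp (V k) y)
          - p * ∫ v, f (dotp v x) * g (dotp v y) ∂(rowG d)|}
      ≤ ENNReal.ofReal (2 * Real.exp (-L ^ 2)) := by
  set θ : ℝ := 1 / (8 * B ^ 2) with hθ
  have hθ0 : 0 < θ := by positivity
  set M : ℝ := Real.exp (1 / 4) * ∫ z, Real.exp (z ^ 2 / 4) ∂stdG with hM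
  have hM0 : 0 ≤ M := mul_nonneg (Real.exp_pos _).le (integral_nonneg fun _ => (Real.exp_pos _).le)
  refine ⟨8 * M / θ ^ 2 + 1, by positivity, θ / 2, by positivity, ?_⟩
  intro f g hf hg hfB hgB d p hd hp L hL hLp x y hx hy
  have hmF : Measurable fun v : Fin d → ℝ => f (dotp v x) * g (dotp v y) :=
    (hf.comp (continuous_dotp x).measurable).mul (hg.comp (continuous_dotp y).measurable)
  have ix : Integrable (fun v => Real.exp ((dotp v x) ^ 2 / 4)) (rowG d) :=
    (map_dotp x hd hx).integrable_comp_of_integrable integrable_exp_sq_stdG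
  have iy : Integrable (fun v => Real.exp ((dotp v y) ^ 2 / 4)) (rowG d) :=
    (map_dotp y hd hy).integrable_comp_of_integrable integrable_exp_sq_stdG
  have i2 : Integrable (fun v => Real.exp (1 / 4) / 2 *
    (Real.exp ((dotp v x) ^ 2 / 4) + Real.exp ((dotp v y) ^ 2 / 4))) (rowG d) := (ix.add iy).const_mul _
  have ex : ∀ w : Fin d → ℝ, ∑ j, w j ^ 2 = d → ∫ v, Real.exp ((dotp v w) ^ 2 / 4) ∂(rowG d)
      = ∫ z, Real.exp (z ^ 2 / 4) ∂stdG := by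
    intro w hw
    rw [← (map_dotp w hd hw).map_eq, integral_map (continuous_dotp w).measurable.aemeasurable
      (by fun_prop)]
  have bd : ∀ v : Fin d → ℝ, Real.exp (θ * |f (dotp v x) * g (dotp v y)|) ≤ Real.exp (1 / 4) / 2 *
    (Real.exp ((dotp v x) ^ 2 / 4) + Real.exp ((dotp v y) ^ 2 / 4)) := by
    intro v
    set a := dotp v x
    set b := dotp v y
    have h1 : |f a * g b| ≤ B ^ 2 * (2 + a ^ 2 + b ^ 2) := by
      rw [abs_mul]
      calc |f a| * |g b| ≤ (B * (1 + |a|)) * (B * (1 + |b|)) :=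
            mul_le_mul (hfB a) (hgB b) (abs_nonneg _) (by positivity)
        _ = B ^ 2 * ((1 + |a|) * (1 + |b|)) := by ring
        _ ≤ B ^ 2 * (2 + a ^ 2 + b ^ 2) := by
          gcongr
          rw [← sq_abs a, ← sq_abs b]
          nlinarith [sq_nonneg (|a| - |b|), sq_nonneg (|a| - 1), sq_nonneg (|b| - 1)]
    have h2 : θ * |f a * g b| ≤ 1 / 4 + (a ^ 2 / 8 + b ^ 2 / 8) := by
      calc θ * |f a * g b| ≤ θ * (B ^ 2 * (2 + a ^ 2 + b ^ 2)) := by gcongr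
        _ = _ := by rw [hθ]; field_simp; ring
    have h3 : Real.exp (a ^ 2 / 8 + b ^ 2 / 8)
        ≤ (Real.exp (a ^ 2 / 4) + Real.exp (b ^ 2 / 4)) / 2 := by
      have e1 : Real.exp (a ^ 2 / 4) = Real.exp (a ^ 2 / 8) ^ 2 := by
        rw [← Real.exp_nat_mul]; congr 1; push_cast; ring
      have e2 : Real.exp (b ^ 2 / 4) = Real.exp (b ^ 2 / 8) ^ 2 := by
        rw [← Real.exp_nat_mul]; congr 1; push_cast; ring
      rw [Real.exp_add, e1, e2]
      nlinarith [sq_nonneg (Real.exp (a ^ 2 / 8) - Real.exp (b ^ 2 / 8))]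
    calc Real.exp (θ * |f a * g b|) ≤ Real.exp (1 / 4 + (a ^ 2 / 8 + b ^ 2 / 8)) :=
          Real.exp_le_exp.2 h2
      _ = Real.exp (1 / 4) * Real.exp (a ^ 2 / 8 + b ^ 2 / 8) := Real.exp_add _ _
      _ ≤ Real.exp (1 / 4) * ((Real.exp (a ^ 2 / 4) + Real.exp (b ^ 2 / 4)) / 2) := by gcongr
      _ = _ := by ring
  have iF : Integrable (fun v => Real.exp (θ * |f (dotp v x) * g (dotp v y)|)) (rowG d) := by
    have hm : Measurable (fun v => Real.exp (θ * |f (dotp v x) * g (dotp v y)|)) :=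
      Real.measurable_exp.comp ((continuous_abs.measurable.comp hmF).const_mul θ)
    refine i2.mono hm.aestronglyMeasurable (ae_of_all _ fun v => ?_)
    rw [Real.norm_eq_abs, Real.abs_exp]
    exact (bd v).trans (le_abs_self _)
  refine bernstein_two (rowG d) _ hmF θ M hθ0 iF ?_ p hp L hL hLp
  calc ∫ v, Real.exp (θ * |f (dotp v x) * g (dotp v y)|) ∂(rowG d)
      ≤ ∫ v, Real.exp (1 / 4) / 2 *
        (Real.exp ((dotp v x) ^ 2 / 4) + Real.exp ((dotp v y) ^ 2 / 4)) ∂(rowG d) :=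
        integral_mono iF i2 bd
    _ = M := by
        rw [integral_const_mul, integral_add ix iy, ex x hx, ex y hy]; ring

lemma eNorm_sq {m : ℕ} (x : Fin m → ℝ) : eNorm x ^ 2 = ∑ j, x j ^ 2 := by
  rw [eNorm, Real.sq_sqrt]; positivity

lemma eNorm_nonneg {m : ℕ} (x : Fin m → ℝ) : 0 ≤ eNorm x := Real.sqrt_nonneg _

lemma eNorm_eq_sqrt_iff {d : ℕ} (x : Fin d → ℝ) : eNorm x = Real.sqrt d ↔ ∑ j, x j ^ 2 = d := by
  rw [eNorm, Real.sqrt_inj (by positivity) (by positivity)]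

lemma dotp_sq_le {m : ℕ} (x y : Fin m → ℝ) : dotp x y ^ 2 ≤ eNorm x ^ 2 * eNorm y ^ 2 := by
  rw [eNorm_sq, eNorm_sq]
  exact Finset.sum_mul_sq_le_sq_mul_sq Finset.univ x y

lemma abs_dotp_le {m : ℕ} (x y : Fin m → ℝ) : |dotp x y| ≤ eNorm x * eNorm y := by
  apply abs_le_of_sq_le_sq
  · rw [mul_pow]; exact dotp_sq_le x y
  · exact mul_nonneg (eNorm_nonneg _) (eNorm_nonneg _)

lemma continuous_dotp' {d : ℕ} (w : Fin d → ℝ) : Continuous fun v : Fin d → ℝ => dotp w v := by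
  unfold dotp; fun_prop

/-- Uniform sub-Gaussian bound. -/
def SubG {d : ℕ} (P : Measure (Fin d → ℝ)) (K : ℝ) : Prop :=
  ∀ u : Fin d → ℝ, eNorm u = 1 → Integrable (fun x => Real.exp ((dotp u x) ^ 2 / K ^ 2)) P ∧
    ∫ x, Real.exp ((dotp u x) ^ 2 / K ^ 2) ∂P ≤ 2

lemma subG_of_data {d : ℕ} {P : Measure (Fin d → ℝ)} {K : ℝ} (h : DataAssumption P K) :
    SubG P (max K 0 + 1) := by
  have := h.prob
  set K' := max K 0 + 1 with hK'
  have hK0 : 0 < K' := by have := le_max_right K 0; linarith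
  have hb : ∀ u : Fin d → ℝ, eNorm u = 1 → ∀ᵐ x ∂P, dotp u x ^ 2 ≤ d := by
    intro u hu
    filter_upwards [h.norm_eq] with x hx
    have := dotp_sq_le u x
    rw [hu, hx, Real.sq_sqrt (by positivity)] at this
    linarith
  have hIntg : ∀ u : Fin d → ℝ, eNorm u = 1 → ∀ t : ℝ, 0 < t →
      Integrable (fun x => Real.exp ((dotp u x) ^ 2 / t ^ 2)) P := by
    intro u hu t ht
    have hm : Continuous (fun x => Real.exp ((dotp u x) ^ 2 / t ^ 2)) := by
      have := continuous_dotp' u; fun_prop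
    refine Integrable.of_bound hm.aestronglyMeasurable (Real.exp (d / t ^ 2)) ?_
    filter_upwards [hb u hu] with x hx
    rw [Real.norm_eq_abs, Real.abs_exp]
    gcongr
  set T : ℝ := Real.sqrt (2 * d) + 1
  have hT0 : 0 < T := by positivity
  have hTm : ∀ u : Fin d → ℝ, eNorm u = 1 →
      T ∈ {t : ℝ | 0 < t ∧ ∫ x, Real.exp ((dotp u x) ^ 2 / t ^ 2) ∂P ≤ 2} := by
    intro u hu
    refine ⟨hT0, ?_⟩
    have h1 : (d : ℝ) / T ^ 2 ≤ 1 / 2 := by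
      rw [div_le_iff₀ (by positivity)]
      have h2 : Real.sqrt (2 * d) ^ 2 = 2 * d := Real.sq_sqrt (by positivity)
      have h3 := Real.sqrt_nonneg (2 * (d:ℝ))
      simp only [T]; nlinarith
    have h2 : Real.exp (1 / 2) ≤ 2 := by
      have h3 : Real.exp (1/2) ^ 2 = Real.exp 1 := by
        rw [← Real.exp_nat_mul]; norm_num
      have := Real.exp_one_lt_d9
      nlinarith [Real.exp_pos (1/2)]
    calc ∫ x, Real.exp ((dotp u x) ^ 2 / T ^ 2) ∂P ≤ ∫ _, (2:ℝ) ∂P := by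
          refine integral_mono_ae (hIntg u hu T hT0) (integrable_const _) ?_
          filter_upwards [hb u hu] with x hx
          refine le_trans (Real.exp_le_exp.2 ?_) h2
          exact le_trans (by gcongr) h1
      _ = 2 := by simp
  have hbb : ∀ u : Fin d → ℝ,
      BddBelow {t : ℝ | 0 < t ∧ ∫ x, Real.exp ((dotp u x) ^ 2 / t ^ 2) ∂P ≤ 2} :=
    fun u => ⟨0, fun t ht => ht.1.le⟩
  have hba : BddAbove (Set.range fun u : {u : Fin d → ℝ // eNorm u = 1} =>
      sInf {t : ℝ | 0 < t ∧ ∫ x, Real.exp ((dotp u.1 x) ^ 2 / t ^ 2) ∂P ≤ 2}) := by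
    refine ⟨T, ?_⟩
    rintro _ ⟨u, rfl⟩
    exact csInf_le (hbb u.1) (hTm u.1 u.2)
  intro u hu
  refine ⟨hIntg u hu K' hK0, ?_⟩
  have h1 := le_ciSup hba ⟨u, hu⟩
  have h2 : sInf {t : ℝ | 0 < t ∧ ∫ x, Real.exp ((dotp u x) ^ 2 / t ^ 2) ∂P ≤ 2} < K' := by
    have := h.subg
    have h3 := le_max_left K 0
    unfold vecSubGNorm at this
    simp only at h1
    linarith
  obtain ⟨t, ⟨ht0, ht⟩, htK⟩ := exists_lt_of_csInf_lt ⟨T, hTm u hu⟩ h2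
  refine le_trans (integral_mono (hIntg u hu K' hK0) (hIntg u hu t ht0) fun x => ?_) ht
  apply Real.exp_le_exp.2
  gcongr

lemma tail_one {d : ℕ} {P : Measure (Fin d → ℝ)} [IsProbabilityMeasure P] {K : ℝ} (hK : 0 < K)
    (h : SubG P K) (hd : 0 < d) (w : Fin d → ℝ) (hw : ∑ j, w j ^ 2 = d) (L : ℝ) (hL : 0 ≤ L) :
    P {x | K * Real.sqrt d * L ≤ |dotp w x|} ≤ ENNReal.ofReal (2 * Real.exp (-L ^ 2)) := by
  have hd' : (0:ℝ) < d := by positivity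
  have hs : 0 < Real.sqrt d := Real.sqrt_pos.2 hd'
  have hss : Real.sqrt d ^ 2 = d := Real.sq_sqrt hd'.le
  set u : Fin d → ℝ := fun j => w j / Real.sqrt d
  have hu : eNorm u = 1 := by
    rw [eNorm, ← Real.sqrt_one]; congr 1
    simp only [u, div_pow]
    rw [← Finset.sum_div, hw, hss, div_self hd'.ne']
  have hwu : ∀ x, dotp w x = Real.sqrt d * dotp u x := by
    intro x
    rw [dotp, dotp, Finset.mul_sum]
    refine Finset.sum_congr rfl fun j _ => ?_
    simp only [u]; field_simp
  obtain ⟨hi, h2⟩ := h u hu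
  rw [ENNReal.le_ofReal_iff_toReal_le (measure_ne_top _ _) (by positivity)]
  change P.real _ ≤ _
  have hm := mul_meas_ge_le_integral_of_nonneg (μ := P) (ae_of_all _ fun x => (Real.exp_pos _).le)
    hi (Real.exp (L ^ 2))
  have hsub : {x | K * Real.sqrt d * L ≤ |dotp w x|}
      ⊆ {x | Real.exp (L ^ 2) ≤ Real.exp ((dotp u x) ^ 2 / K ^ 2)} := by
    intro x hx
    rw [Set.mem_ofPred_eq] at hx ⊢
    apply Real.exp_le_exp.2
    rw [hwu, abs_mul, abs_of_pos hs] at hx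
    have h3 : K * L ≤ |dotp u x| := by
      by_contra hc
      push Not at hc
      nlinarith
    rw [le_div_iff₀ (by positivity), ← sq_abs (dotp u x)]
    calc L ^ 2 * K ^ 2 = (K * L) ^ 2 := by ring
      _ ≤ _ := by gcongr
  have h4 : P.real {x | K * Real.sqrt d * L ≤ |dotp w x|} ≤
    P.real {x | Real.exp (L ^ 2) ≤ Real.exp ((dotp u x) ^ 2 / K ^ 2)} :=
    measureReal_mono hsub (measure_ne_top _ _)
  have h5 : Real.exp (L ^ 2) * P.real {x | K * Real.sqrt d * L ≤ |dotp w x|} ≤ 2 :=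
    (mul_le_mul_of_nonneg_left h4 (Real.exp_pos _).le).trans (hm.trans h2)
  rw [Real.exp_neg, ← div_eq_mul_inv, le_div_iff₀ (Real.exp_pos _)]
  linarith

lemma tail_sum {d n : ℕ} {P : Measure (Fin d → ℝ)} [IsProbabilityMeasure P] {K : ℝ} (hK : 0 < K)
    (h : SubG P K) (u : Fin d → ℝ) (hu : eNorm u = 1) (T : ℝ) :
    (Measure.pi fun _ : Fin n => P) {X | K ^ 2 * T ≤ ∑ i, dotp u (X i) ^ 2}
      ≤ ENNReal.ofReal (2 ^ n * Real.exp (-T)) := by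
  obtain ⟨hi, h2⟩ := h u hu
  rw [ENNReal.le_ofReal_iff_toReal_le (measure_ne_top _ _) (by positivity)]
  change (Measure.pi fun _ : Fin n => P).real _ ≤ _
  have e : ∀ X : Fin n → Fin d → ℝ, Real.exp ((∑ i, dotp u (X i) ^ 2) / K ^ 2)
      = ∏ i, Real.exp (dotp u (X i) ^ 2 / K ^ 2) := by
    intro X; rw [← Real.exp_sum, Finset.sum_div]
  have hiX : Integrable (fun X : Fin n → Fin d → ℝ => Real.exp ((∑ i, dotp u (X i) ^ 2) / K ^ 2))
      (Measure.pi fun _ => P) := by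
    simp_rw [e]
    exact Integrable.fintype_prod (f := fun _ x => Real.exp (dotp u x ^ 2 / K ^ 2)) fun _ => hi
  have h2X : ∫ X : Fin n → Fin d → ℝ, Real.exp ((∑ i, dotp u (X i) ^ 2) / K ^ 2)
      ∂(Measure.pi fun _ => P) ≤ 2 ^ n := by
    simp_rw [e]
    rw [integral_fintype_prod_eq_pow (𝕜 := ℝ) (fun x => Real.exp (dotp u x ^ 2 / K ^ 2)),
      Fintype.card_fin]
    exact pow_le_pow_left₀ (integral_nonneg fun _ => (Real.exp_pos _).le) h2 n
  have hm := mul_meas_ge_le_integral_of_nonneg (ae_of_all _ fun x => (Real.exp_pos _).le)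
    hiX (Real.exp T)
  have hset : {X : Fin n → Fin d → ℝ | K ^ 2 * T ≤ ∑ i, dotp u (X i) ^ 2}
      = {X | Real.exp T ≤ Real.exp ((∑ i, dotp u (X i) ^ 2) / K ^ 2)} := by
    ext X
    rw [Set.mem_ofPred_eq, Set.mem_ofPred_eq, Real.exp_le_exp, le_div_iff₀ (by positivity), mul_comm]
  rw [hset]
  rw [Real.exp_neg, ← div_eq_mul_inv, le_div_iff₀ (Real.exp_pos _), mul_comm]
  exact hm.trans h2X

lemma exists_net (d : ℕ) : ∃ N : Finset (EuclideanSpace ℝ (Fin d)), N.card ≤ 5 ^ d ∧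
    (∀ c ∈ N, ‖c‖ = 2) ∧ ∀ z : EuclideanSpace ℝ (Fin d), ‖z‖ = 2 → ∃ c ∈ N, ‖z - c‖ < 1 := by
  let Q : Set ℕ := {k | ∃ N : Finset (EuclideanSpace ℝ (Fin d)), N.card = k ∧ (∀ c ∈ N, ‖c‖ = 2) ∧
    ∀ c ∈ N, ∀ c' ∈ N, c ≠ c' → 1 ≤ ‖c - c'‖}
  have hQ : ∀ k ∈ Q, k ≤ 5 ^ d := by
    rintro k ⟨N, rfl, h1, h2⟩
    have := Besicovitch.card_le_of_separated N (fun c hc => (h1 c hc).le) h2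
    rwa [finrank_euclideanSpace_fin] at this
  have hne : Q.Nonempty := ⟨0, ∅, by simp⟩
  obtain ⟨k, hk, hmax⟩ := BddAbove.exists_isGreatest_of_nonempty ⟨5 ^ d, hQ⟩ hne
  have hk5 := hQ k hk
  obtain ⟨N, rfl, h1, h2⟩ := hk
  refine ⟨N, hk5, h1, fun z hz => ?_⟩
  by_contra hc
  push Not at hc
  have hzN : z ∉ N := fun hzN => by have := hc z hzN; simp at this; linarith
  classical
  have : N.card + 1 ∈ Q := by
    refine ⟨insert z N, Finset.card_insert_of_notMem hzN, ?_, ?_⟩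
    · intro c hcN
      rcases Finset.mem_insert.1 hcN with rfl | h
      · exact hz
      · exact h1 c h
    · intro c hcN c' hcN' hne
      rcases Finset.mem_insert.1 hcN with rfl | h
      · rcases Finset.mem_insert.1 hcN' with rfl | h'
        · exact absurd rfl hne
        · exact hc c' h'
      · rcases Finset.mem_insert.1 hcN' with rfl | h'
        · rw [norm_sub_rev]; exact hc c h
        · exact h2 c h c' h' hne
  have := hmax this
  omega

lemma eNorm_eq_norm {m : ℕ} (x : Fin m → ℝ) : eNorm x = ‖WithLp.toLp 2 x‖ := by
  rw [EuclideanSpace.norm_eq, eNorm]; simp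

lemma eNorm_eq_norm' {m : ℕ} (x : EuclideanSpace ℝ (Fin m)) : eNorm x.ofLp = ‖x‖ := by
  rw [eNorm_eq_norm]

lemma op_det {d n : ℕ} (X : Fin n → Fin d → ℝ) (N : Finset (EuclideanSpace ℝ (Fin d)))
    (hN : ∀ z : EuclideanSpace ℝ (Fin d), ‖z‖ = 2 → ∃ c ∈ N, ‖z - c‖ < 1) (T : ℝ)
    (hT : 0 ≤ T) (h : ∀ c ∈ N, ∑ i, dotp c.ofLp (X i) ^ 2 ≤ 4 * T ^ 2) (a : Fin n → ℝ) :
    eNorm (fun j => ∑ i, a i * X i j) ≤ 2 * T * eNorm a := by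
  let A : EuclideanSpace ℝ (Fin d) →L[ℝ] EuclideanSpace ℝ (Fin n) :=
    LinearMap.toContinuousLinearMap (Matrix.toEuclideanLin (Matrix.of X))
  have hA : ∀ z, ‖A z‖ ^ 2 = ∑ i, dotp z.ofLp (X i) ^ 2 := by
    intro z
    rw [EuclideanSpace.norm_sq_eq]
    refine Finset.sum_congr rfl fun i _ => ?_
    rw [Real.norm_eq_abs, sq_abs]
    congr 1
    simp only [A, LinearMap.coe_toContinuousLinearMap', Matrix.toLpLin_apply,
      Matrix.mulVec, dotProduct, Matrix.of_apply, dotp]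
    exact Finset.sum_congr rfl fun j _ => mul_comm _ _
  have hAc : ∀ c ∈ N, ‖A c‖ ≤ 2 * T := by
    intro c hc
    apply le_of_sq_le_sq _ (by positivity)
    rw [hA]; exact (h c hc).trans (by nlinarith)
  have hAn : ‖A‖ ≤ T + ‖A‖ / 2 := by
    refine A.opNorm_le_bound (by positivity) fun z => ?_
    by_cases hz : z = 0
    · simp [hz]
    have hz0 : 0 < ‖z‖ := norm_pos_iff.2 hz
    set w : EuclideanSpace ℝ (Fin d) := (2 / ‖z‖) • z with hw
    have hwn : ‖w‖ = 2 := by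
      rw [hw, norm_smul, Real.norm_eq_abs, abs_of_pos (by positivity)]; field_simp
    obtain ⟨c, hc, hcw⟩ := hN w hwn
    have h1 : ‖A w‖ ≤ 2 * T + ‖A‖ := by
      calc ‖A w‖ = ‖A c + A (w - c)‖ := by rw [← map_add]; congr 2; abel
        _ ≤ ‖A c‖ + ‖A (w - c)‖ := norm_add_le _ _
        _ ≤ 2 * T + ‖A‖ * ‖w - c‖ := add_le_add (hAc c hc) (A.le_opNorm _)
        _ ≤ 2 * T + ‖A‖ * 1 := by gcongr
        _ = _ := by ring
    have h2 : A w = (2 / ‖z‖) • A z := by rw [hw, map_smul]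
    rw [h2, norm_smul, Real.norm_eq_abs, abs_of_pos (by positivity), div_mul_eq_mul_div,
      div_le_iff₀ hz0] at h1
    linarith
  have hA2 : ‖A‖ ≤ 2 * T := by linarith
  set w : Fin d → ℝ := fun j => ∑ i, a i * X i j with hw
  have e1 : eNorm w ^ 2 = dotp a (fun i => dotp w (X i)) := by
    rw [eNorm_sq, dotp]
    simp only [dotp, Finset.mul_sum]
    rw [Finset.sum_comm]
    refine Finset.sum_congr rfl fun j _ => ?_
    rw [pow_two]
    nth_rewrite 2 [hw]
    simp only
    rw [Finset.mul_sum]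
    exact Finset.sum_congr rfl fun i _ => by ring
  have e2 : eNorm (fun i => dotp w (X i)) ≤ 2 * T * eNorm w := by
    have h3 := A.le_opNorm (WithLp.toLp 2 w)
    have h4 : eNorm (fun i => dotp w (X i)) = ‖A (WithLp.toLp 2 w)‖ := by
      rw [← sq_eq_sq₀ (eNorm_nonneg _) (norm_nonneg _), eNorm_sq, hA]
    rw [h4, eNorm_eq_norm w]
    exact h3.trans (by gcongr)
  have e3 : eNorm w ^ 2 ≤ eNorm a * (2 * T * eNorm w) := by
    rw [e1]
    exact (le_abs_self _).trans ((abs_dotp_le _ _).trans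
      (mul_le_mul_of_nonneg_left e2 (eNorm_nonneg _)))
  rcases (eNorm_nonneg w).eq_or_lt with h0 | h0
  · rw [← h0]; exact mul_nonneg (by positivity) (eNorm_nonneg _)
  · by_contra hc
    push Not at hc
    nlinarith

lemma op_bad {d n : ℕ} {P : Measure (Fin d → ℝ)} [IsProbabilityMeasure P] {K : ℝ} (hK : 0 < K)
    (h : SubG P K) (C₀ : ℝ) (hn : (n : ℝ) ≤ C₀ * d) :
    ∃ Bad : Set (Fin n → Fin d → ℝ),
      (Measure.pi fun _ : Fin n => P) Bad ≤ ENNReal.ofReal (Real.exp (-d)) ∧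
      ∀ X ∉ Bad, ∀ a : Fin n → ℝ, eNorm (fun j => ∑ i, a i * X i j)
        ≤ 2 * (K * Real.sqrt ((C₀ + 3) * d)) * eNorm a := by
  obtain ⟨N, hc, hN2, hN⟩ := exists_net d
  have hC : 0 ≤ (C₀ + 3) * d := by
    have : (0:ℝ) ≤ n := by positivity
    have : (0:ℝ) ≤ d := by positivity
    nlinarith
  set T := (C₀ + 3) * d with hT
  set S : EuclideanSpace ℝ (Fin d) → Set (Fin n → Fin d → ℝ) := fun c =>
    {X | K ^ 2 * T ≤ ∑ i, dotp (fun j => c.ofLp j / 2) (X i) ^ 2} with hS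
  refine ⟨⋃ c ∈ N, S c, ?_, ?_⟩
  · have h1 : ∀ c ∈ N, (Measure.pi fun _ : Fin n => P) (S c)
        ≤ ENNReal.ofReal (2 ^ n * Real.exp (-T)) := by
      intro c hcN
      refine tail_sum hK h _ ?_ T
      have := hN2 c hcN
      rw [← eNorm_eq_norm'] at this
      have h4 := eNorm_sq c.ofLp
      rw [eNorm, ← Real.sqrt_one]; congr 1
      simp only [div_pow]
      rw [← Finset.sum_div, ← h4, this]; norm_num
    refine (measure_biUnion_finset_le N S).trans ((Finset.sum_le_sum h1).trans ?_)
    rw [Finset.sum_const, nsmul_eq_mul, ← ENNReal.ofReal_natCast, ← ENNReal.ofReal_mul (by positivity)]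
    apply ENNReal.ofReal_le_ofReal
    have h5 : (N.card : ℝ) ≤ Real.exp (2 * d) := by
      have : (N.card : ℝ) ≤ 5 ^ d := by exact_mod_cast hc
      refine this.trans ?_
      rw [mul_comm, Real.exp_nat_mul]
      gcongr
      have h3 : Real.exp 2 = Real.exp 1 ^ 2 := by rw [← Real.exp_nat_mul]; norm_num
      rw [h3]; nlinarith [Real.exp_one_gt_d9]
    have h6 : (2:ℝ) ^ n ≤ Real.exp (C₀ * d) := by
      have : (2:ℝ) ^ n ≤ Real.exp 1 ^ n := by gcongr; nlinarith [Real.exp_one_gt_d9]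
      refine this.trans ?_
      rw [← Real.exp_nat_mul, mul_one]; exact Real.exp_le_exp.2 hn
    calc (N.card : ℝ) * (2 ^ n * Real.exp (-T)) ≤ Real.exp (2 * d) * (Real.exp (C₀ * d) * Real.exp (-T)) := by
          gcongr
      _ = Real.exp (-d) := by rw [← Real.exp_add, ← Real.exp_add, hT]; congr 1; ring
  · intro X hX a
    refine op_det X N hN (K * Real.sqrt T) (by positivity) (fun c hcN => ?_) a
    have h7 : X ∉ S c := fun hh => hX (Set.mem_biUnion hcN hh)
    simp only [hS, Set.mem_ofPred_eq, not_le] at h7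
    have h8 : ∑ i, dotp c.ofLp (X i) ^ 2 = 4 * ∑ i, dotp (fun j => c.ofLp j / 2) (X i) ^ 2 := by
      rw [Finset.mul_sum]
      refine Finset.sum_congr rfl fun i _ => ?_
      have : dotp c.ofLp (X i) = 2 * dotp (fun j => c.ofLp j / 2) (X i) := by
        rw [dotp, dotp, Finset.mul_sum]; exact Finset.sum_congr rfl fun j _ => by ring
      rw [this]; ring
    rw [h8, mul_pow, Real.sq_sqrt hC]
    linarith

lemma prod_bad_symm {α β : Type*} [MeasurableSpace α] [MeasurableSpace β] (μ : Measure α)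
    (ν : Measure β) [IsProbabilityMeasure μ] [IsProbabilityMeasure ν] (E : Set (α × β))
    (hE : MeasurableSet E) (ε : ENNReal) (h : ∀ b, μ {a | (a, b) ∈ E} ≤ ε) :
    (μ.prod ν) E ≤ ε := by
  rw [Measure.prod_apply_symm hE]
  calc ∫⁻ y, μ ((fun x => (x, y)) ⁻¹' E) ∂ν ≤ ∫⁻ _, ε ∂ν := lintegral_mono fun y => h y
    _ = ε := by simp

lemma prod_snd_bad {α β : Type*} [MeasurableSpace α] [MeasurableSpace β] (μ : Measure α)
    (ν : Measure β) [IsProbabilityMeasure μ] [IsProbabilityMeasure ν] (S : Set β) :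
    (μ.prod ν) (Prod.snd ⁻¹' S) = ν S := by
  rw [← Set.univ_prod, Measure.prod_prod]; simp

lemma pair_bad {d n : ℕ} {P : Measure (Fin d → ℝ)} [IsProbabilityMeasure P] {K : ℝ} (hK : 0 < K)
    (h : SubG P K) (hd : 0 < d) (L : ℝ) (hL : 0 ≤ L) (i j : Fin n) :
    (Measure.pi fun _ : Fin n => P)
      {X | i ≠ j ∧ ∑ k, X i k ^ 2 = d ∧ K * Real.sqrt d * L ≤ |dotp (X i) (X j)|}
      ≤ ENNReal.ofReal (2 * Real.exp (-L ^ 2)) := by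
  by_cases hij : i = j
  · simp [hij]
  set E : Set ((Fin d → ℝ) × (Fin d → ℝ)) :=
    {q | ∑ k, q.2 k ^ 2 = d ∧ K * Real.sqrt d * L ≤ |dotp q.2 q.1|} with hE
  have hEm : MeasurableSet E := by
    apply IsClosed.measurableSet
    refine IsClosed.inter (s₁ := {q : (Fin d → ℝ) × (Fin d → ℝ) | ∑ k, q.2 k ^ 2 = (d:ℝ)})
      (s₂ := {q : (Fin d → ℝ) × (Fin d → ℝ) | K * Real.sqrt d * L ≤ |dotp q.2 q.1|}) ?_ ?_
    · exact isClosed_eq (by fun_prop) continuous_const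
    · refine isClosed_le continuous_const ?_
      unfold dotp; fun_prop
  have hind := iIndepFun_pi (μ := fun _ : Fin n => P) (X := fun _ x => x) (fun _ => aemeasurable_id)
  have hpair := hind.indepFun (Ne.symm hij)
  rw [indepFun_iff_map_prod_eq_prod_map_map (measurable_pi_apply j).aemeasurable
    (measurable_pi_apply i).aemeasurable] at hpair
  have hmap : ∀ k : Fin n, (Measure.pi fun _ : Fin n => P).map (fun X => X k) = P := fun k =>
    (measurePreserving_eval (fun _ : Fin n => P) k).map_eq
  simp only [hmap] at hpair
  have hb := prod_bad_symm P P E hEm (ENNReal.ofReal (2 * Real.exp (-L ^ 2))) (fun b => by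
    by_cases hb : ∑ k, b k ^ 2 = (d:ℝ)
    · refine (measure_mono ?_).trans (tail_one hK h hd b hb L hL)
      intro x hx
      exact hx.2
    · have : {a | (a, b) ∈ E} = ∅ := by
        ext a; simp [hE, hb]
      rw [this]; simp)
  rw [← hpair, Measure.map_apply (by fun_prop) hEm] at hb
  refine (measure_mono ?_).trans hb
  intro X hX
  exact hX.2

lemma norm_null {d n : ℕ} {P : Measure (Fin d → ℝ)} [IsProbabilityMeasure P]
    (h : ∀ᵐ x ∂P, eNorm x = Real.sqrt d) :
    (Measure.pi fun _ : Fin n => P) {X | ¬ ∀ i, ∑ k, X i k ^ 2 = d} = 0 := by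
  rw [← ae_iff, ae_all_iff]
  intro i
  have := (Measure.quasiMeasurePreserving_eval (μ := fun _ : Fin n => P) i).ae h
  filter_upwards [this] with X hX
  exact (eNorm_eq_sqrt_iff _).1 hX

instance (p d : ℕ) : IsProbabilityMeasure (gaussianMatrix p d) := by
  unfold gaussianMatrix; infer_instance

lemma dotp_tf {φ : ℝ → ℝ} {p d : ℕ} (V : Fin p → Fin d → ℝ) (x y : Fin d → ℝ) :
    dotp (tfeatureMap φ V x) (tfeatureMap φ V y)
      = ∑ k, tphi φ (dotp (V k) x) * tphi φ (dotp (V k) y) := rfl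

lemma conc_cross {φ : ℝ → ℝ} (hφ : ActivationAssumptionCore φ) {C₁ : ℝ}
    {d p n : ℕ} (hd : 0 < d) (L : ℝ) (P : Measure (Fin d → ℝ)) [IsProbabilityMeasure P]
    (hconc : ∀ x y : Fin d → ℝ, ∑ j, x j ^ 2 = d → ∑ j, y j ^ 2 = d →
      (gaussianMatrix p d) {V | C₁ * Real.sqrt p * L ≤
        |∑ k, tphi φ (dotp (V k) x) * tphi φ (dotp (V k) y)
          - p * ∫ v, tphi φ (dotp v x) * tphi φ (dotp v y) ∂(rowG d)|}
      ≤ ENNReal.ofReal (2 * Real.exp (-L ^ 2))) (i j : Fin n) :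
    ((gaussianMatrix p d).prod (Measure.pi fun _ : Fin n => P))
      {ω | (∑ k, ω.2 i k ^ 2 = d ∧ ∑ k, ω.2 j k ^ 2 = d) ∧
        C₁ * Real.sqrt p * L + (if i = j then 0 else p * (tmu2 φ * |dotp (ω.2 i) (ω.2 j) / d| ^ 3)) ≤
        |dotp (tfeatureMap φ ω.1 (ω.2 i)) (tfeatureMap φ ω.1 (ω.2 j))
          - (if i = j then p * tmu2 φ else 0)|}
      ≤ ENNReal.ofReal (2 * Real.exp (-L ^ 2)) := by
  have hc := tphi_continuous hφ
  apply prod_bad_symm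
  · apply IsClosed.measurableSet
    rw [Set.ofPred_and]
    refine IsClosed.inter ?_ (isClosed_le ?_ ?_)
    · exact (isClosed_eq (by fun_prop) continuous_const).inter
        (isClosed_eq (by fun_prop) continuous_const)
    · split_ifs
      · fun_prop
      · unfold dotp; fun_prop
    · simp only [dotp_tf]; unfold dotp; fun_prop
  · intro X
    by_cases hX : ∑ k, X i k ^ 2 = (d:ℝ) ∧ ∑ k, X j k ^ 2 = (d:ℝ)
    · refine (measure_mono ?_).trans (hconc (X i) (X j) hX.1 hX.2)
      rintro V ⟨-, hV⟩
      rw [Set.mem_ofPred_eq]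
      simp only [dotp_tf] at hV
      set Sm := ∑ k, tphi φ (dotp (V k) (X i)) * tphi φ (dotp (V k) (X j))
      split_ifs at hV with hij
      · subst hij
        rw [mean_self hφ (X i) hd hX.1]
        linarith
      · have h1 := mean_cross hφ (X i) (X j) hd hX.1 hX.2
        set I := ∫ v, tphi φ (dotp v (X i)) * tphi φ (dotp v (X j)) ∂(rowG d)
        have h2 : |Sm - 0| ≤ |Sm - p * I| + |p * I| := by
          rw [sub_zero]
          calc |Sm| = |(Sm - p * I) + p * I| := by congr 1; ring
            _ ≤ _ := abs_add_le _ _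
        have h3 : |(p:ℝ) * I| ≤ p * (tmu2 φ * |dotp (X i) (X j) / d| ^ 3) := by
          rw [abs_mul, abs_of_nonneg (by positivity : (0:ℝ) ≤ p)]
          gcongr
        linarith
    · have : {V | (V, X) ∈ {ω : (Fin p → Fin d → ℝ) × (Fin n → Fin d → ℝ) |
          (∑ k, ω.2 i k ^ 2 = (d:ℝ) ∧ ∑ k, ω.2 j k ^ 2 = (d:ℝ)) ∧
        C₁ * Real.sqrt p * L + (if i = j then 0 else p * (tmu2 φ * |dotp (ω.2 i) (ω.2 j) / d| ^ 3)) ≤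
        |dotp (tfeatureMap φ ω.1 (ω.2 i)) (tfeatureMap φ ω.1 (ω.2 j))
          - (if i = j then p * tmu2 φ else 0)|}} = ∅ := by
        ext V
        simp only [Set.mem_ofPred_eq, Set.mem_empty_iff_false, iff_false]
        exact fun hh => hX hh.1
      rw [this]; simp

lemma dotp_basis {d : ℕ} (v : Fin d → ℝ) (j : Fin d) :
    dotp v (Pi.single j (Real.sqrt d)) = v j * Real.sqrt d := by
  rw [dotp, Finset.sum_eq_single j]
  · simp
  · intro b _ hb; simp [Pi.single_eq_of_ne hb]
  · simp

lemma norm_basis {d : ℕ} (j : Fin d) :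
    ∑ k, (Pi.single j (Real.sqrt d) : Fin d → ℝ) k ^ 2 = d := by
  rw [Finset.sum_eq_single j]
  · simp
  · intro b _ hb; simp [Pi.single_eq_of_ne hb]
  · simp

lemma conc_lin {φ : ℝ → ℝ} (hφ : ActivationAssumptionCore φ) {C₁ : ℝ}
    {d p n : ℕ} (hd : 0 < d) (L : ℝ) (P : Measure (Fin d → ℝ)) [IsProbabilityMeasure P]
    (hconc : ∀ x y : Fin d → ℝ, ∑ j, x j ^ 2 = d → ∑ j, y j ^ 2 = d →
      (gaussianMatrix p d) {V | C₁ * Real.sqrt p * L ≤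
        |∑ k, tphi φ (dotp (V k) x) * dotp (V k) y
          - p * ∫ v, tphi φ (dotp v x) * dotp v y ∂(rowG d)|}
      ≤ ENNReal.ofReal (2 * Real.exp (-L ^ 2))) (i : Fin n) (j : Fin d) :
    ((gaussianMatrix p d).prod (Measure.pi fun _ : Fin n => P))
      {ω | (∑ k, ω.2 i k ^ 2 = d) ∧
        C₁ * Real.sqrt p * L ≤
        |∑ k, tphi φ (dotp (ω.1 k) (ω.2 i)) * (ω.1 k j * Real.sqrt d)|}
      ≤ ENNReal.ofReal (2 * Real.exp (-L ^ 2)) := by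
  have hc := tphi_continuous hφ
  apply prod_bad_symm
  · apply IsClosed.measurableSet
    rw [Set.ofPred_and]
    refine IsClosed.inter (isClosed_eq (by fun_prop) continuous_const) (isClosed_le ?_ ?_)
    · fun_prop
    · unfold dotp; fun_prop
  · intro X
    by_cases hX : ∑ k, X i k ^ 2 = (d:ℝ)
    · refine (measure_mono ?_).trans (hconc (X i) _ hX (norm_basis j))
      rintro V ⟨-, hV⟩
      rw [Set.mem_ofPred_eq, mean_lin hφ _ _ hd hX (norm_basis j)]
      simp only [dotp_basis]
      rw [mul_zero, sub_zero]; exact hV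
    · have : {V | (V, X) ∈ {ω : (Fin p → Fin d → ℝ) × (Fin n → Fin d → ℝ) |
         (∑ k, ω.2 i k ^ 2 = (d:ℝ)) ∧ C₁ * Real.sqrt p * L ≤
        |∑ k, tphi φ (dotp (ω.1 k) (ω.2 i)) * (ω.1 k j * Real.sqrt d)|}} = ∅ := by
        ext V
        simp only [Set.mem_ofPred_eq, Set.mem_empty_iff_false, iff_false]
        exact fun hh => hX hh.1
      rw [this]; simp

lemma eNorm_le_of_abs_le {m : ℕ} (x : Fin m → ℝ) (R : ℝ) (hR : 0 ≤ R) (h : ∀ j, |x j| ≤ R) :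
    eNorm x ≤ Real.sqrt m * R := by
  rw [eNorm, ← Real.sqrt_sq hR, ← Real.sqrt_mul (by positivity)]
  apply Real.sqrt_le_sqrt
  calc ∑ j, x j ^ 2 ≤ ∑ _j : Fin m, R ^ 2 := Finset.sum_le_sum fun j _ => by
        rw [← sq_abs]; exact pow_le_pow_left₀ (abs_nonneg _) (h j) 2
    _ = m * R ^ 2 := by simp

lemma eNorm_sub_le {m : ℕ} (x y : Fin m → ℝ) : eNorm (fun j => x j - y j) ≤ eNorm x + eNorm y := by
  rw [eNorm_eq_norm, eNorm_eq_norm, eNorm_eq_norm]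
  exact norm_sub_le (WithLp.toLp 2 x) (WithLp.toLp 2 y)

/-- Deterministic part. -/
lemma det_part {φ : ℝ → ℝ} {d p n : ℕ} (hd : 0 < d) (V : Fin p → Fin d → ℝ)
    (X : Fin n → Fin d → ℝ) (R S W : ℝ) (hR : 0 ≤ R) (hS : 0 ≤ S)
    (h1 : ∀ i j, |dotp (tfeatureMap φ V (X i)) (tfeatureMap φ V (X j))
          - (if i = j then p * tmu2 φ else 0)| ≤ S)
    (h2 : ∀ i j, |∑ k, tphi φ (dotp (V k) (X i)) * (V k j * Real.sqrt d)| ≤ R)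
    (h3 : ∀ a : Fin n → ℝ, eNorm (fun j => ∑ i, a i * X i j) ≤ W * eNorm a)
    (xh : Fin d → ℝ) (hxh : eNorm xh = Real.sqrt d) (a : Fin n → ℝ)
    (ha : featureMap φ V xh = (fun k => ∑ i, a i * featureMap φ V (X i) k)) (i : Fin n) :
    |dotp (tfeatureMap φ V (X i)) (tfeatureMap φ V xh) - tmu2 φ * p * a i| ≤
      eNorm a * (Real.sqrt n * S) + |hermiteCoeff φ 1| * (R * (W * eNorm a + Real.sqrt d)) := by
  set μ₁ := hermiteCoeff φ 1 with hμ
  set w : Fin d → ℝ := fun j => ∑ i, a i * X i j with hw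
  set z : Fin d → ℝ := fun j => w j - xh j with hz
  set t := tfeatureMap φ V (X i) with ht
  set Δ : Fin n → ℝ := fun j => dotp t (tfeatureMap φ V (X j)) - (if i = j then p * tmu2 φ else 0)
    with hΔ
  set g : Fin d → ℝ := fun j => ∑ k, t k * V k j with hg
  have hVw : ∀ k, dotp (V k) w = ∑ j, a j * dotp (V k) (X j) := by
    intro k
    simp only [dotp, hw, Finset.mul_sum]
    rw [Finset.sum_comm]
    exact Finset.sum_congr rfl fun _ _ => Finset.sum_congr rfl fun _ _ => by ring
  have hVz : ∀ k, dotp (V k) z = dotp (V k) w - dotp (V k) xh := by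
    intro k
    simp only [dotp, hz, mul_sub, Finset.sum_sub_distrib]
  have e1 : ∀ k, tfeatureMap φ V xh k
      = ∑ j, a j * tfeatureMap φ V (X j) k + μ₁ * dotp (V k) z := by
    intro k
    have hk := congrFun ha k
    simp only [featureMap] at hk
    simp only [tfeatureMap]
    rw [hk, hVz, hVw, ← hμ]
    simp only [mul_sub, Finset.sum_sub_distrib, Finset.mul_sum]
    have : ∀ j, a j * (μ₁ * dotp (V k) (X j)) = μ₁ * (a j * dotp (V k) (X j)) := fun j => by ring
    simp only [this]; ring
  have e2 : dotp t (tfeatureMap φ V xh)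
      = ∑ j, a j * dotp t (tfeatureMap φ V (X j)) + μ₁ * dotp g z := by
    have : ∀ k, t k * tfeatureMap φ V xh k = ∑ j, a j * (t k * tfeatureMap φ V (X j) k)
        + μ₁ * ∑ j, t k * V k j * z j := by
      intro k
      rw [e1 k, mul_add, Finset.mul_sum, dotp]
      congr 1
      · exact Finset.sum_congr rfl fun _ _ => by ring
      · rw [mul_left_comm, Finset.mul_sum]
        congr 1
        exact Finset.sum_congr rfl fun _ _ => by ring
    rw [dotp, Finset.sum_congr rfl fun k _ => this k, Finset.sum_add_distrib, ← Finset.mul_sum]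
    congr 1
    · rw [Finset.sum_comm]
      exact Finset.sum_congr rfl fun _ _ => by rw [← Finset.mul_sum, dotp]
    · congr 1
      rw [Finset.sum_comm, dotp]
      exact Finset.sum_congr rfl fun _ _ => by rw [← Finset.sum_mul]
  have e3 : dotp a Δ = ∑ j, a j * dotp t (tfeatureMap φ V (X j)) - tmu2 φ * p * a i := by
    have : dotp a Δ = ∑ j, (a j * dotp t (tfeatureMap φ V (X j))
        - a j * (if i = j then p * tmu2 φ else 0)) := by
      rw [dotp]; exact Finset.sum_congr rfl fun j _ => by rw [hΔ, mul_sub]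
    rw [this, Finset.sum_sub_distrib]
    congr 1
    rw [Finset.sum_eq_single i (fun j _ hj => by rw [if_neg (Ne.symm hj), mul_zero]) (by simp),
      if_pos rfl]
    ring
  have e4 : dotp t (tfeatureMap φ V xh) - tmu2 φ * p * a i = dotp a Δ + μ₁ * dotp g z := by
    rw [e2, e3]; ring
  rw [e4]
  have b1 : |dotp a Δ| ≤ eNorm a * (Real.sqrt n * S) :=
    (abs_dotp_le a Δ).trans (mul_le_mul_of_nonneg_left
      (eNorm_le_of_abs_le Δ S hS fun j => h1 i j) (eNorm_nonneg _))
  have hsd : 0 < Real.sqrt d := Real.sqrt_pos.2 (by positivity)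
  have b2 : eNorm g ≤ R := by
    have := eNorm_le_of_abs_le g (R / Real.sqrt d) (by positivity) (fun j => by
      rw [le_div_iff₀ hsd]
      have h := h2 i j
      have e : ∑ k, tphi φ (dotp (V k) (X i)) * (V k j * Real.sqrt d) = g j * Real.sqrt d := by
        simp only [hg, Finset.sum_mul]
        exact Finset.sum_congr rfl fun k _ => by
          rw [ht, mul_assoc]; rfl
      rw [e, abs_mul, abs_of_pos hsd] at h
      exact h)
    refine this.trans (le_of_eq ?_)
    field_simp
  have b3 : eNorm z ≤ W * eNorm a + Real.sqrt d := by
    rw [← hxh]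
    exact (eNorm_sub_le w xh).trans (add_le_add (h3 a) le_rfl)
  calc |dotp a Δ + μ₁ * dotp g z| ≤ |dotp a Δ| + |μ₁ * dotp g z| := abs_add_le _ _
    _ = |dotp a Δ| + |μ₁| * |dotp g z| := by rw [abs_mul]
    _ ≤ eNorm a * (Real.sqrt n * S) + |μ₁| * (R * (W * eNorm a + Real.sqrt d)) := by
        refine add_le_add b1 (mul_le_mul_of_nonneg_left ?_ (abs_nonneg _))
        exact (abs_dotp_le g z).trans (mul_le_mul b2 b3 (eNorm_nonneg _) hR)

lemma card_union_bound {α ι : Type*} [MeasurableSpace α] [Fintype ι] (μ : Measure α)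
    (E : ι → Set α) (ε : ℝ) (hε : 0 ≤ ε) (h : ∀ i, μ (E i) ≤ ENNReal.ofReal ε) :
    μ (⋃ i, E i) ≤ ENNReal.ofReal (Fintype.card ι * ε) := by
  refine (measure_iUnion_fintype_le μ E).trans ((Finset.sum_le_sum fun i _ => h i).trans ?_)
  rw [Finset.sum_const, nsmul_eq_mul, ENNReal.ofReal_mul (by positivity), ENNReal.ofReal_natCast]
  rfl

/-- The good event. -/
lemma good_event {φ : ℝ → ℝ} (hφ : ActivationAssumptionCore φ) :
    ∃ C₁ : ℝ, 0 < C₁ ∧ ∃ c₁ : ℝ, 0 < c₁ ∧ ∀ (d p n : ℕ), 0 < d → 0 < p → ∀ L : ℝ, 0 ≤ L →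
    L ≤ c₁ * Real.sqrt p → ∀ (P : Measure (Fin d → ℝ)) [IsProbabilityMeasure P] (K : ℝ), 0 < K →
    SubG P K → (∀ᵐ x ∂P, eNorm x = Real.sqrt d) → ∀ C₀ : ℝ, (n : ℝ) ≤ C₀ * d →
    ∃ Bad : Set ((Fin p → Fin d → ℝ) × (Fin n → Fin d → ℝ)),
      ((gaussianMatrix p d).prod (Measure.pi fun _ : Fin n => P)) Bad ≤
        ENNReal.ofReal (2 * (2 * n ^ 2 + n * d) * Real.exp (-L ^ 2) + Real.exp (-d)) ∧
      ∀ ω ∉ Bad,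
        (∀ i j, |dotp (tfeatureMap φ ω.1 (ω.2 i)) (tfeatureMap φ ω.1 (ω.2 j))
          - (if i = j then p * tmu2 φ else 0)|
            ≤ C₁ * Real.sqrt p * L + p * (tmu2 φ * (K * L / Real.sqrt d) ^ 3)) ∧
        (∀ i j, |∑ k, tphi φ (dotp (ω.1 k) (ω.2 i)) * (ω.1 k j * Real.sqrt d)|
          ≤ C₁ * Real.sqrt p * L) ∧
        (∀ a : Fin n → ℝ, eNorm (fun j => ∑ i, a i * ω.2 i j)
          ≤ 2 * (K * Real.sqrt ((C₀ + 3) * d)) * eNorm a) := by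
  obtain ⟨B, hB, hgr⟩ := tphi_growth hφ
  obtain ⟨C₁, hC₁, c₁, hc₁, hconc⟩ := feat_conc B hB
  refine ⟨C₁, hC₁, c₁, hc₁, ?_⟩
  intro d p n hd hp L hL hLp P _ K hK hsub hnorm C₀ hn
  have hmt := (tphi_continuous hφ).measurable
  have hid : ∀ z : ℝ, |z| ≤ B * (1 + |z|) := by
    intro z; have := abs_nonneg z; nlinarith
  have c1 := fun x y hx hy => hconc (tphi φ) (tphi φ) hmt hmt hgr hgr d p hd hp L hL hLp x y hx hy
  have c2 := fun x y hx hy => hconc (tphi φ) (fun z => z) hmt measurable_id hgr hid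
    d p hd hp L hL hLp x y hx hy
  obtain ⟨Bop, hBop, hop⟩ := op_bad (n := n) hK hsub C₀ hn
  set μ := (gaussianMatrix p d).prod (Measure.pi fun _ : Fin n => P) with hμ
  have q1 := fun q : Fin n × Fin n => conc_cross hφ hd L P c1 q.1 q.2
  have q2 := fun q : Fin n × Fin d => conc_lin hφ hd L P c2 q.1 q.2
  have q3 : ∀ q : Fin n × Fin n, μ (Prod.snd ⁻¹' {X | q.1 ≠ q.2 ∧ ∑ k, X q.1 k ^ 2 = (d:ℝ) ∧
      K * Real.sqrt d * L ≤ |dotp (X q.1) (X q.2)|}) ≤ ENNReal.ofReal (2 * Real.exp (-L ^ 2)) := by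
    intro q
    rw [hμ, prod_snd_bad]
    exact pair_bad hK hsub hd L hL q.1 q.2
  have q4 : μ (Prod.snd ⁻¹' Bop) ≤ ENNReal.ofReal (Real.exp (-d)) := by
    rw [hμ, prod_snd_bad]; exact hBop
  have q5 : μ (Prod.snd ⁻¹' {X | ¬ ∀ i, ∑ k, X i k ^ 2 = (d:ℝ)}) = 0 := by
    rw [hμ, prod_snd_bad]; exact norm_null hnorm
  have hε : 0 ≤ 2 * Real.exp (-L ^ 2) := by positivity
  have u1 := card_union_bound μ _ _ hε q1
  have u2 := card_union_bound μ _ _ hε q2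
  have u3 := card_union_bound μ _ _ hε q3
  refine ⟨(⋃ q : Fin n × Fin n, _) ∪ (⋃ q : Fin n × Fin d, _) ∪ (⋃ q : Fin n × Fin n, _) ∪ _ ∪ _,
    (measure_union_le _ _).trans (le_of_le_of_eq (add_le_add ((measure_union_le _ _).trans
      (add_le_add ((measure_union_le _ _).trans
      (add_le_add ((measure_union_le _ _).trans (add_le_add u1 u2)) u3)) q4)) q5.le) ?_), ?_⟩
  · rw [add_zero, ← ENNReal.ofReal_add (by positivity) (by positivity),
      ← ENNReal.ofReal_add (by positivity) (by positivity),
      ← ENNReal.ofReal_add (by positivity) (by positivity)]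
    congr 1
    simp only [Fintype.card_prod, Fintype.card_fin]
    push_cast
    ring
  · intro ω hω
    simp only [Set.mem_union, not_or, Set.mem_iUnion, not_exists] at hω
    obtain ⟨⟨⟨⟨n1, n2⟩, n3⟩, n4⟩, n5⟩ := hω
    have hno : ∀ i, ∑ k, ω.2 i k ^ 2 = (d:ℝ) := by
      by_contra hc; exact n5 hc
    have hd' : (0:ℝ) < d := by positivity
    have hsd : 0 < Real.sqrt d := Real.sqrt_pos.2 hd'
    have htm := tmu2_nonneg φ
    refine ⟨?_, ?_, ?_⟩
    · intro i j
      have h := n1 (i, j)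
      simp only [Set.mem_ofPred_eq, not_and, not_le] at h
      have h := h ⟨hno i, hno j⟩
      refine h.le.trans (add_le_add le_rfl ?_)
      split_ifs with hij
      · positivity
      · have h3 := n3 (i, j)
        simp only [Set.mem_preimage, Set.mem_ofPred_eq, not_and, not_le] at h3
        have h3 := h3 hij (hno i)
        gcongr
        rw [abs_div, abs_of_pos hd', div_le_div_iff₀ hd' hsd]
        have hss : Real.sqrt d ^ 2 = d := Real.sq_sqrt hd'.le
        calc |dotp (ω.2 i) (ω.2 j)| * Real.sqrt d ≤ (K * Real.sqrt d * L) * Real.sqrt d := by gcongr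
          _ = K * L * Real.sqrt d ^ 2 := by ring
          _ = _ := by rw [hss]
    · intro i j
      have h := n2 (i, j)
      simp only [Set.mem_ofPred_eq, not_and, not_le] at h
      exact (h (hno i)).le
    · exact fun a => hop ω.2 n4 a

theorem final_ineq {α C₁ T1 T2 T3 tm K' m Q : ℝ} (h1 : 0 ≤ α) (h2 : 0 ≤ C₁) (p1 : 0 ≤ T1)
    (p2 : 0 ≤ T2) (p3 : 0 ≤ T3) (h3 : 0 ≤ tm) (h4 : 0 ≤ K') (h5 : 0 ≤ m) (h6 : 0 ≤ Q) :
    α * (C₁ * T2) + α * (tm * K' ^ 3 * T3) + m * C₁ * (2 * K' * Q * α + 1) * T1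
      ≤ (C₁ + tm * K' ^ 3 + m * C₁ * (2 * K' * Q + 1)) * (α + 1) * (T1 + T2 + T3) := by
  have f1 : α * (C₁ * T2) ≤ C₁ * (α + 1) * (T1 + T2 + T3) := by
    calc α * (C₁ * T2) = C₁ * α * T2 := by ring
      _ ≤ C₁ * (α + 1) * (T1 + T2 + T3) := by gcongr <;> linarith
  have f2 : α * (tm * K' ^ 3 * T3) ≤ tm * K' ^ 3 * (α + 1) * (T1 + T2 + T3) := by
    calc α * (tm * K' ^ 3 * T3) = tm * K' ^ 3 * α * T3 := by ring
      _ ≤ tm * K' ^ 3 * (α + 1) * (T1 + T2 + T3) := by gcongr <;> linarith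
  have f3 : m * C₁ * (2 * K' * Q * α + 1) * T1
      ≤ m * C₁ * (2 * K' * Q + 1) * (α + 1) * (T1 + T2 + T3) := by
    have : 2 * K' * Q * α + 1 ≤ (2 * K' * Q + 1) * (α + 1) := by
      have : 0 ≤ 2 * K' * Q := by positivity
      nlinarith
    calc m * C₁ * (2 * K' * Q * α + 1) * T1
        ≤ m * C₁ * ((2 * K' * Q + 1) * (α + 1)) * (T1 + T2 + T3) := by gcongr; linarith
      _ = _ := by ring
  linarith

set_option maxHeartbeats 1000000 in
/-- **Lemma A.2 (Extraction of expansion coefficients).**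
Under the random features setup and the data, activation, and scaling assumptions:
there are constants `c, C > 0` such that for all sufficiently large `d`, with probability
at least `1 − 2 exp(−c log² d)` over `V` and the data, simultaneously for every `x̂` on the
sphere of radius `√d` and every coefficient vector `a` with `φ(x̂) = Σᵢ aᵢ φ(xᵢ)`:
`|φ̃(xᵢ)ᵀφ̃(x̂) − μ̃² p aᵢ| ≤ C (‖a‖₂ + 1)(√(pd) log d + √(pn) log d + p √n log³ d / d^{3/2})`. -/
theorem coefficient_extraction
    (φ : ℝ → ℝ) (hφ : ActivationAssumptionCore φ)
    (K C₀ : ℝ)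
    (n p : ℕ → ℕ)
    (P : (d : ℕ) → Measure (Fin d → ℝ))
    (hdata : ∀ d, DataAssumption (P d) K)
    (hn : ∀ d : ℕ, (n d : ℝ) ≤ C₀ * d)
    (hp : Tendsto (fun d : ℕ => (p d : ℝ) / ((n d : ℝ) * d * (Real.log d) ^ 2))
      atTop atTop) :
    ∃ c : ℝ, 0 < c ∧ ∃ C : ℝ, 0 < C ∧ ∃ D : ℕ, ∀ d : ℕ, D ≤ d →
      1 - ENNReal.ofReal (2 * Real.exp (-c * (Real.log d) ^ 2)) ≤
        ((gaussianMatrix (p d) d).prod (Measure.pi fun _ : Fin (n d) => P d))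
          {ω | ∀ xh : Fin d → ℝ, eNorm xh = Real.sqrt d →
            ∀ a : Fin (n d) → ℝ,
              featureMap φ ω.1 xh =
                (fun k => ∑ i, a i * featureMap φ ω.1 (ω.2 i) k) →
              ∀ i : Fin (n d),
                |dotp (tfeatureMap φ ω.1 (ω.2 i)) (tfeatureMap φ ω.1 xh) -
                    tmu2 φ * (p d) * a i| ≤
                  C * (eNorm a + 1) *
                    (Real.sqrt ((p d : ℝ) * d) * Real.log d +
                      Real.sqrt ((p d : ℝ) * (n d)) * Real.log d +
                      (p d : ℝ) * Real.sqrt (n d) * (Real.log d) ^ 3 /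
                        (d : ℝ) ^ ((3 : ℝ) / 2))} := by
  obtain ⟨C₁, hC₁, c₁, hc₁, hgood⟩ := good_event hφ
  set K' := max K 0 + 1 with hK'
  have hK0 : 0 < K' := by have := le_max_right K 0; linarith
  set Q := Real.sqrt (C₀ + 3) with hQ
  have hQ0 : 0 ≤ Q := Real.sqrt_nonneg _
  have htm := tmu2_nonneg φ
  set A : ℝ := 2 * (2 * C₀ ^ 2 + C₀) with hA
  have hlog : Tendsto (fun d : ℕ => Real.log d) atTop atTop :=
    Real.tendsto_log_atTop.comp tendsto_natCast_atTop_atTop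
  have ev1 := hp.eventually_ge_atTop (1 / c₁ ^ 2 + 1)
  have ev2 := hlog.eventually_ge_atTop (max 4 A)
  have ev3 := eventually_ge_atTop 1 (α := ℕ)
  obtain ⟨D, hD⟩ := eventually_atTop.1 (ev1.and (ev2.and ev3))
  refine ⟨1 / 4, by norm_num,
    C₁ + tmu2 φ * K' ^ 3 + |hermiteCoeff φ 1| * C₁ * (2 * K' * Q + 1), by positivity, D, ?_⟩
  intro d hdD
  obtain ⟨h1, h2, h3⟩ := hD d hdD
  have hprob := (hdata d).prob
  set L := Real.log d with hL
  have hL4 : 4 ≤ L := (le_max_left _ _).trans h2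
  have hLA : A ≤ L := (le_max_right _ _).trans h2
  have hd0 : (0:ℝ) < d := by exact_mod_cast h3
  have hd1 : (1:ℝ) ≤ d := by exact_mod_cast h3
  have hsd : 0 < Real.sqrt d := Real.sqrt_pos.2 hd0
  have hnpos : 0 < n d := by
    rcases Nat.eq_zero_or_pos (n d) with h | h
    · exfalso
      rw [h] at h1
      simp only [Nat.cast_zero, zero_mul, div_zero] at h1
      have : 0 < 1 / c₁ ^ 2 := by positivity
      linarith
    · exact h
  have hn1 : (1:ℝ) ≤ n d := by exact_mod_cast hnpos
  have hpL : (1 / c₁ ^ 2 + 1) * L ^ 2 ≤ p d := by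
    rw [le_div_iff₀ (by positivity)] at h1
    refine le_trans ?_ h1
    have : L ^ 2 ≤ (n d : ℝ) * d * L ^ 2 := by
      have : 1 ≤ (n d : ℝ) * d := one_le_mul_of_one_le_of_one_le hn1 hd1
      nlinarith [sq_nonneg L]
    gcongr
  have hppos : 0 < p d := by
    have : (0:ℝ) < p d := lt_of_lt_of_le (by positivity) hpL
    exact_mod_cast this
  have hp0 : (0:ℝ) < p d := by exact_mod_cast hppos
  have hLp : L ≤ c₁ * Real.sqrt (p d) := by
    apply le_of_sq_le_sq _ (by positivity)
    rw [mul_pow, Real.sq_sqrt hp0.le]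
    have : c₁ ^ 2 * ((1 / c₁ ^ 2 + 1) * L ^ 2) ≤ c₁ ^ 2 * p d := by gcongr
    have e : c₁ ^ 2 * ((1 / c₁ ^ 2 + 1) * L ^ 2) = L ^ 2 + c₁ ^ 2 * L ^ 2 := by field_simp
    have : 0 ≤ c₁ ^ 2 * L ^ 2 := by positivity
    linarith
  obtain ⟨Bad, hBad, hG⟩ := hgood d (p d) (n d) h3 hppos L (by linarith) hLp (P d) K' hK0
    (subG_of_data (hdata d)) (hdata d).norm_eq C₀ (hn d)
  set μ := (gaussianMatrix (p d) d).prod (Measure.pi fun _ : Fin (n d) => P d) with hμ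
  set S := {ω : (Fin (p d) → Fin d → ℝ) × (Fin (n d) → Fin d → ℝ) |
          ∀ xh : Fin d → ℝ, eNorm xh = Real.sqrt d →
            ∀ a : Fin (n d) → ℝ,
              featureMap φ ω.1 xh =
                (fun k => ∑ i, a i * featureMap φ ω.1 (ω.2 i) k) →
              ∀ i : Fin (n d),
                |dotp (tfeatureMap φ ω.1 (ω.2 i)) (tfeatureMap φ ω.1 xh) -
                    tmu2 φ * (p d) * a i| ≤
                  (C₁ + tmu2 φ * K' ^ 3 + |hermiteCoeff φ 1| * C₁ * (2 * K' * Q + 1)) *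
                    (eNorm a + 1) *
                    (Real.sqrt ((p d : ℝ) * d) * L +
                      Real.sqrt ((p d : ℝ) * (n d)) * L +
                      (p d : ℝ) * Real.sqrt (n d) * L ^ 3 /
                        (d : ℝ) ^ ((3 : ℝ) / 2))} with hS
  -- probability
  have hbound : μ Bad ≤ ENNReal.ofReal (2 * Real.exp (-(1 / 4) * L ^ 2)) := by
    refine hBad.trans (ENNReal.ofReal_le_ofReal ?_)
    have hdL : (d:ℝ) = Real.exp L := (Real.exp_log hd0).symm
    have b1 : 2 * (2 * (n d : ℝ) ^ 2 + n d * d) ≤ A * d ^ 2 := by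
      have x1 := hn d
      have x2 : (n d : ℝ) ^ 2 ≤ (C₀ * d) ^ 2 := by gcongr
      have x3 : (n d : ℝ) * d ≤ C₀ * d * d := by gcongr
      rw [hA]; nlinarith
    have b2 : A * d ^ 2 ≤ Real.exp (3 * L) := by
      have x1 : A ≤ Real.exp L := hLA.trans (by linarith [Real.add_one_le_exp L])
      calc A * d ^ 2 ≤ Real.exp L * d ^ 2 := by gcongr
        _ = Real.exp (3 * L) := by
          rw [hdL, ← Real.exp_nat_mul, ← Real.exp_add]; congr 1; push_cast; ring
    have b3 : 2 * (2 * (n d : ℝ) ^ 2 + n d * d) * Real.exp (-L ^ 2)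
        ≤ Real.exp (-(1 / 4) * L ^ 2) := by
      calc _ ≤ Real.exp (3 * L) * Real.exp (-L ^ 2) := by gcongr; exact b1.trans b2
        _ = Real.exp (3 * L + -L ^ 2) := (Real.exp_add _ _).symm
        _ ≤ _ := Real.exp_le_exp.2 (by nlinarith)
    have b4 : Real.exp (-d) ≤ Real.exp (-(1 / 4) * L ^ 2) := by
      apply Real.exp_le_exp.2
      have x1 : L ≤ 2 * Real.sqrt d := by
        have := Real.log_le_sub_one_of_pos hsd
        rw [Real.log_sqrt hd0.le] at this
        linarith
      have x2 : Real.sqrt d ^ 2 = d := Real.sq_sqrt hd0.le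
      nlinarith
    linarith
  have hsub : Badᶜ ⊆ S := by
    intro ω hω
    obtain ⟨g1, g2, g3⟩ := hG ω hω
    rw [hS, Set.mem_ofPred_eq]
    intro xh hxh a ha i
    have hL0 : 0 ≤ L := by linarith
    have hmain := det_part h3 ω.1 ω.2 (C₁ * Real.sqrt (p d) * L)
      (C₁ * Real.sqrt (p d) * L + p d * (tmu2 φ * (K' * L / Real.sqrt d) ^ 3))
      (2 * (K' * Real.sqrt ((C₀ + 3) * d))) (by positivity) (by positivity) g1 g2 g3 xh hxh a ha i
    refine hmain.trans ?_
    have hna := eNorm_nonneg a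
    have e1 : Real.sqrt ((C₀ + 3) * d) = Q * Real.sqrt d := Real.sqrt_mul' _ hd0.le
    have e2 : (d : ℝ) ^ ((3 : ℝ) / 2) = Real.sqrt d ^ 3 := by
      rw [Real.sqrt_eq_rpow, ← Real.rpow_natCast, ← Real.rpow_mul hd0.le]; norm_num
    rw [e1, e2, Real.sqrt_mul hp0.le, Real.sqrt_mul hp0.le]
    set α := eNorm a
    set T1 := Real.sqrt (p d) * Real.sqrt d * L with hT1
    set T2 := Real.sqrt (p d) * Real.sqrt (n d) * L with hT2
    set T3 := (p d : ℝ) * Real.sqrt (n d) * L ^ 3 / Real.sqrt d ^ 3 with hT3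
    have p1 : 0 ≤ T1 := by positivity
    have p2 : 0 ≤ T2 := by positivity
    have p3 : 0 ≤ T3 := by positivity
    set m := |hermiteCoeff φ 1| with hm
    have hm0 : 0 ≤ m := abs_nonneg _
    have e3 : α * (Real.sqrt (n d) * (C₁ * Real.sqrt (p d) * L
          + p d * (tmu2 φ * (K' * L / Real.sqrt d) ^ 3)))
        + m * (C₁ * Real.sqrt (p d) * L * (2 * (K' * (Q * Real.sqrt d)) * α + Real.sqrt d))
        = α * (C₁ * T2) + α * (tmu2 φ * K' ^ 3 * T3)
          + m * C₁ * (2 * K' * Q * α + 1) * T1 := by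
      rw [hT1, hT2, hT3, div_pow, mul_pow]; ring
    rw [e3]
    exact final_ineq hna hC₁.le p1 p2 p3 htm hK0.le hm0 hQ0
  have hone : 1 ≤ μ S + μ Bad := by
    have : μ Set.univ ≤ μ (S ∪ Bad) := measure_mono fun ω _ => by
      by_cases h : ω ∈ Bad
      · exact Or.inr h
      · exact Or.inl (hsub h)
    have hu : μ Set.univ = 1 := by rw [hμ]; exact measure_univ
    rw [hu] at this
    exact this.trans (measure_union_le _ _)
  rw [tsub_le_iff_right]
  exact hone.trans (by gcongr)
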